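/- Fix ε > 0. There is a constant A > 0 such that for all sufficiently large D there exist at least D^{1−ε} fundamental discriminants d ≤ D for which 𝓛_{χ_d} ≤ −(log log log D) + A and L(s, χ_d) has no Siegel zero. -/

import Mathlib

open Filter


/-- The Dirichlet L-function of `χ` (extended by `0` for modulus `0`). -/
noncomputable def LFun (d : ℕ) (χ : DirichletCharacter ℂ d) (s : ℂ) : ℂ :=
  if h : d ≠ 0 then
    letI : NeZero d := ⟨h⟩
    DirichletCharacter.LFunction χ s
  else 0

/-- `𝓛_χ = Σ_p χ(p)/p` has value `L`: the partial sums over primes `p < y`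
converge to `L` as `y → ∞`. -/
def HasCurlyL {d : ℕ} (χ : DirichletCharacter ℂ d) (L : ℝ) : Prop :=
  Filter.Tendsto
    (fun y : ℕ => ∑ p ∈ (Finset.range y).filter Nat.Prime, (χ p).re / (p : ℝ))
    Filter.atTop (nhds L)

/-- Number of ordered pairs `(p, q)` of primes with `p * q ≤ x` satisfying `P p q`. -/
noncomputable def pairCount (x : ℝ) (P : ℕ → ℕ → Prop) : ℕ :=
  Nat.card {pq : ℕ × ℕ // pq.1.Prime ∧ pq.2.Prime ∧ ((pq.1 * pq.2 : ℕ) : ℝ) ≤ x ∧ P pq.1 pq.2}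

/-- The race ratio `#{pq ≤ x : χ(p) = χ(q) = η} / ((1/4) #{pq ≤ x : gcd(pq, d) = 1})`,
where products of two primes are counted as ordered pairs. -/
noncomputable def raceRatio {d : ℕ} (χ : DirichletCharacter ℂ d) (η : ℂ) (x : ℝ) : ℝ :=
  (pairCount x (fun p q => χ p = η ∧ χ q = η) : ℝ) /
    ((1 / 4 : ℝ) * (pairCount x (fun p q => Nat.gcd (p * q) d = 1) : ℝ))

/-- A positive integer is a fundamental discriminant if it is `≡ 1 (mod 4)` and squarefree,
or is `4m` with `m ≡ 2, 3 (mod 4)` squarefree. -/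
def IsFundamentalDiscriminant (d : ℕ) : Prop :=
  0 < d ∧ ((d % 4 = 1 ∧ Squarefree d) ∨
    (d % 4 = 0 ∧ Squarefree (d / 4) ∧ (d / 4 % 4 = 2 ∨ d / 4 % 4 = 3)))

/-- The Generalized Riemann Hypothesis for Dirichlet L-functions: all zeros in the
critical strip lie on the critical line. -/
def GRH : Prop :=
  ∀ (d : ℕ), d ≠ 0 → ∀ (χ : DirichletCharacter ℂ d) (s : ℂ),
    LFun d χ s = 0 → 0 < s.re → s.re < 1 → s.re = 1 / 2

/-- `L(s, χ)` has no real zero `β` with `1 - c / log d ≤ β ≤ 1` (a Siegel zero). -/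
def HasNoSiegelZero (c : ℝ) (d : ℕ) (χ : DirichletCharacter ℂ d) : Prop :=
  ¬ ∃ β : ℝ, 1 - c / Real.log d ≤ β ∧ β ≤ 1 ∧ LFun d χ (β : ℂ) = 0

/-- The logarithmic integral `Li(t) = ∫_2^t du / log u`. -/
noncomputable def Li (t : ℝ) : ℝ := ∫ u in (2:ℝ)..t, 1 / Real.log u


/-- The Jacobi symbol as a Dirichlet character. -/
noncomputable def jchar (q : ℕ) [NeZero q] : DirichletCharacter ℂ q where
  toFun x := ((jacobiSym (x.val : ℤ) q : ℤ) : ℂ)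
  map_one' := by
    rcases eq_or_ne q 1 with h | h
    · subst h; simp
    · have : Fact (1 < q) := ⟨by have := NeZero.ne q; omega⟩
      rw [ZMod.val_one]; simp
  map_mul' x y := by
    rw [ZMod.val_mul, ← Int.cast_mul, ← jacobiSym.mul_left]
    congr 1
    rw [jacobiSym.mod_left (a := ((x.val * y.val % q : ℕ) : ℤ)), jacobiSym.mod_left (a := (x.val:ℤ) * y.val)]
    push_cast
    rw [Int.emod_emod_of_dvd _ dvd_rfl]
  map_nonunit' x hx := by
    rw [Int.cast_eq_zero, jacobiSym.eq_zero_iff_not_coprime]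
    intro h
    apply hx
    rw [← ZMod.natCast_zmod_val x, ZMod.isUnit_iff_coprime]
    rwa [Int.gcd_natCast_natCast] at h

lemma jchar_natCast (q : ℕ) [NeZero q] (n : ℕ) :
    jchar q (n : ZMod q) = ((jacobiSym n q : ℤ) : ℂ) := by
  change ((jacobiSym (((n : ZMod q)).val : ℤ) q : ℤ) : ℂ) = _
  rw [ZMod.val_natCast, jacobiSym.mod_left (a := (n : ℤ))]
  push_cast; rfl

lemma jchar_quadratic (q : ℕ) [NeZero q] : MulChar.IsQuadratic (jchar q) := by
  intro x
  have e : jchar q x = ((jacobiSym (x.val : ℤ) q : ℤ) : ℂ) := rfl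
  rw [e]
  rcases jacobiSym.trichotomy (x.val : ℤ) q with h | h | h <;> rw [h] <;> norm_num

/-- for `q` odd squarefree and a prime `p ∣ q`, there is `n ≡ 1 mod q / p` with symbol `-1`. -/
lemma exists_jacobi_neg (q p : ℕ) (hq : Odd q) (hs : Squarefree q) (hp : p.Prime) (hpq : p ∣ q) :
    ∃ n : ℕ, n ≡ 1 [MOD q / p] ∧ jacobiSym n q = -1 := by
  obtain ⟨r, rfl⟩ := hpq
  have hp2 : p ≠ 2 := by
    rintro rfl
    exact (Nat.not_even_iff_odd.mpr hq) (even_two.mul_right r)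
  have hco : Nat.Coprime p r := Nat.coprime_of_squarefree_mul hs
  have : Fact p.Prime := ⟨hp⟩
  obtain ⟨b, hb⟩ := FiniteField.exists_nonsquare (F := ZMod p) (by rwa [ZMod.ringChar_zmod_n])
  obtain ⟨n, hn1, hn2⟩ := Nat.chineseRemainder hco b.val 1
  refine ⟨n, by rwa [Nat.mul_div_cancel_left _ hp.pos], ?_⟩
  have hr : NeZero r := ⟨by rintro rfl; simp at hs⟩
  have : NeZero p := ⟨hp.ne_zero⟩
  rw [jacobiSym.mul_right, jacobiSym.mod_left (b := r)]
  have e : ((n : ℤ) % r) = ((1 : ℤ) % r) := by exact_mod_cast hn2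
  rw [e, ← jacobiSym.mod_left, jacobiSym.one_left, mul_one, ← jacobiSym.legendreSym.to_jacobiSym,
    legendreSym.eq_neg_one_iff]
  have : ((n : ℤ) : ZMod p) = b := by
    rw [Int.cast_natCast, (ZMod.natCast_eq_natCast_iff _ _ _).mpr hn1, ZMod.natCast_zmod_val]
  rwa [this]

lemma jchar_primitive (q : ℕ) [NeZero q] (hq : Odd q) (hs : Squarefree q) :
    (jchar q).IsPrimitive := by
  rw [DirichletCharacter.isPrimitive_def]
  by_contra hne
  have hdvd := (jchar q).conductor_dvd_level
  have hfac := (jchar q).factorsThrough_conductor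
  set e := (jchar q).conductor with he
  obtain ⟨r, hr⟩ := hdvd
  have hr1 : r ≠ 1 := by rintro rfl; apply hne; omega
  obtain ⟨p, hp, hpr⟩ := Nat.exists_prime_and_dvd hr1
  obtain ⟨n, hn, hj⟩ := exists_jacobi_neg q p hq hs hp (hpr.trans ⟨e, by rw [hr, mul_comm]⟩)
  have hen : n ≡ 1 [MOD e] := by
    obtain ⟨s, rfl⟩ := hpr
    refine hn.of_dvd ⟨s, ?_⟩
    rw [hr, show e * (p * s) = p * (e * s) by ring, Nat.mul_div_cancel_left _ hp.pos]
  obtain ⟨hd, χ0, hχ⟩ := hfac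
  have hu : IsUnit (n : ZMod q) := by
    rw [ZMod.isUnit_iff_coprime]
    by_contra hc
    have : jacobiSym n q = 0 := by
      rw [jacobiSym.eq_zero_iff_not_coprime]; rwa [Int.gcd_natCast_natCast]
    omega
  have h1 : jchar q (n : ZMod q) = -1 := by rw [jchar_natCast, hj]; simp
  rw [hχ] at h1
  obtain ⟨u, hu⟩ := hu
  rw [← hu, DirichletCharacter.changeLevel_eq_cast_of_dvd] at h1
  have : ((u : ZMod q).cast : ZMod e) = 1 := by
    rw [hu, ZMod.cast_natCast hd, (ZMod.natCast_eq_natCast_iff _ _ _).mpr hen, Nat.cast_one]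
  rw [this, map_one] at h1
  norm_num at h1

lemma jchar_ne_one (q : ℕ) [NeZero q] (hq : Odd q) (hs : Squarefree q) (h1 : 1 < q) :
    jchar q ≠ 1 := by
  intro h
  have h2 := jchar_primitive q hq hs
  rw [DirichletCharacter.isPrimitive_def, h, DirichletCharacter.conductor_one] at h2
  omega


open ZMod in
lemma norm_gaussSum_quad (q : ℕ) [NeZero q] (χ : DirichletCharacter ℂ q) (hp : χ.IsPrimitive)
    (hquad : MulChar.IsQuadratic χ) : ‖gaussSum χ (ZMod.stdAddChar (N := q))‖ ^ 2 = q := by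
  set τ := gaussSum χ (ZMod.stdAddChar (N := q)) with hτ
  have h1 : 𝓕 (χ : ZMod q → ℂ) = (χ (-1) * τ) • (χ : ZMod q → ℂ) := by
    funext k
    rw [hp.fourierTransform_eq_inv_mul_gaussSum, hquad.inv, ← neg_one_mul, map_mul, Pi.smul_apply,
      smul_eq_mul]
    ring
  have h2 := dft_dft (χ : ZMod q → ℂ)
  rw [h1, dft_const_smul, h1] at h2
  have h3 := congrFun h2 1
  simp only [Pi.smul_apply, map_one, smul_eq_mul, mul_one] at h3
  have h4 : ‖χ (-1)‖ = 1 := by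
    have : χ (-1) * χ (-1) = 1 := by rw [← map_mul]; simp
    have := congrArg norm this
    rw [norm_mul, norm_one] at this
    nlinarith [norm_nonneg (χ (-1))]
  have h5 := congrArg norm h3
  rw [norm_mul, norm_mul, norm_mul, h4] at h5
  simp only [one_mul, mul_one, Complex.norm_natCast] at h5
  rw [pow_two, h5]

lemma norm_geom_le (q v H : ℕ) (h0 : 0 < v) (hv : v < q) :
    ‖∑ n ∈ Finset.range H, (Complex.exp (2 * Real.pi * Complex.I * v / q)) ^ n‖ ≤
      (q : ℝ) / 2 * (1 / v + 1 / ((q - v : ℕ) : ℝ)) := by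
  set θ : ℝ := 2 * Real.pi * v / q with hθ
  have hq : (0 : ℝ) < q := by exact_mod_cast (h0.trans hv)
  have hvR : (0 : ℝ) < v := by exact_mod_cast h0
  have hvq : (v : ℝ) < q := by exact_mod_cast hv
  have hw : Complex.exp (2 * Real.pi * Complex.I * v / q) = Complex.exp (Complex.I * θ) := by
    congr 1; rw [hθ]; push_cast; ring
  set w := Complex.exp (2 * Real.pi * Complex.I * v / q) with hwdef
  have hnw : ‖w‖ = 1 := by rw [hw, mul_comm]; exact Complex.norm_exp_ofReal_mul_I θ
  have hn : ‖w - 1‖ = 2 * |Real.sin (θ / 2)| := by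
    rw [hw, Complex.norm_exp_I_mul_ofReal_sub_one, norm_mul]; simp
  have hcast : ((q - v : ℕ) : ℝ) = q - v := by rw [Nat.cast_sub hv.le]
  -- lower bound for sine
  have hpi := Real.pi_pos
  have hsin : min (2 * (v : ℝ) / q) (2 * ((q : ℝ) - v) / q) ≤ |Real.sin (θ / 2)| := by
    have e1 : θ / 2 = Real.pi * v / q := by rw [hθ]; ring
    rcases le_total (2 * (v : ℝ)) q with h | h
    · refine (min_le_left _ _).trans (le_trans ?_ (le_abs_self _))
      have := Real.mul_le_sin (x := θ / 2) (by rw [e1]; positivity)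
        (by rw [e1, div_le_div_iff₀ hq two_pos]; nlinarith)
      refine le_trans (le_of_eq ?_) this
      rw [e1]; field_simp
    · refine (min_le_right _ _).trans (le_trans ?_ (le_abs_self _))
      have := Real.mul_le_sin (x := Real.pi - θ / 2)
        (by rw [e1, sub_nonneg, div_le_iff₀ hq]; nlinarith)
        (by rw [e1, sub_le_comm, le_div_iff₀ hq]; nlinarith)
      rw [Real.sin_pi_sub] at this
      refine le_trans (le_of_eq ?_) this
      rw [e1]; field_simp
  have hmin : 0 < min (2 * (v : ℝ) / q) (2 * ((q : ℝ) - v) / q) := by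
    apply lt_min
    · positivity
    · apply div_pos _ hq; linarith
  have hne : w ≠ 1 := by
    intro h
    rw [h, sub_self, norm_zero] at hn
    linarith
  rw [geom_sum_eq hne, norm_div, hn]
  have hnum : ‖w ^ H - 1‖ ≤ 2 := by
    refine (norm_sub_le _ _).trans ?_
    rw [norm_pow, hnw]; norm_num
  have hstep : ‖w ^ H - 1‖ / (2 * |Real.sin (θ / 2)|) ≤
      1 / min (2 * (v : ℝ) / q) (2 * ((q : ℝ) - v) / q) := by
    rw [div_le_div_iff₀ (by linarith) hmin]
    nlinarith
  refine hstep.trans ?_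
  rw [hcast]
  have hqv : (0 : ℝ) < q - v := by linarith
  rcases min_choice (2 * (v : ℝ) / q) (2 * ((q : ℝ) - v) / q) with h | h <;> rw [h]
  · rw [one_div_div, mul_add]
    have : (q : ℝ) / 2 * (1 / v) = q / (2 * v) := by field_simp
    rw [this]
    have : 0 ≤ (q : ℝ) / 2 * (1 / (q - v)) := by positivity
    linarith
  · rw [one_div_div, mul_add]
    have : (q : ℝ) / 2 * (1 / (q - v)) = q / (2 * (q - v)) := by field_simp
    rw [this]
    have : 0 ≤ (q : ℝ) / 2 * (1 / v) := by positivity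
    linarith

lemma sum_inv_le_log (q : ℕ) : ∑ v ∈ Finset.Ico 1 q, (1 : ℝ) / v ≤ 1 + Real.log q := by
  rcases Nat.eq_zero_or_pos q with h | h
  · subst h; simp
  have h1 := harmonic_le_one_add_log q
  refine le_trans ?_ h1
  rw [harmonic_eq_sum_Icc]
  push_cast
  simp only [one_div]
  apply Finset.sum_le_sum_of_subset_of_nonneg
  · intro x; simp; omega
  · intros; positivity

lemma polya_vinogradov (q : ℕ) [NeZero q] (h1 : 1 < q) (χ : DirichletCharacter ℂ q)
    (hp : χ.IsPrimitive) (hquad : MulChar.IsQuadratic χ) (hχ : χ ≠ 1) (A H : ℕ) :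
    ‖∑ n ∈ Finset.range H, χ ((A + n : ℕ) : ZMod q)‖ ≤ Real.sqrt q * (1 + Real.log q) := by
  set e := ZMod.stdAddChar (N := q) with he
  set τ := gaussSum χ e with hτ
  have hτn : ‖τ‖ ^ 2 = q := norm_gaussSum_quad q χ hp hquad
  have hτs : ‖τ‖ = Real.sqrt q := by
    rw [← hτn, Real.sqrt_sq (norm_nonneg _)]
  have key : τ * ∑ n ∈ Finset.range H, χ ((A + n : ℕ) : ZMod q) =
      ∑ x : ZMod q, χ x * (e (A * x) * ∑ n ∈ Finset.range H, (e x) ^ n) := by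
    rw [Finset.mul_sum]
    have : ∀ n ∈ Finset.range H, τ * χ ((A + n : ℕ) : ZMod q) =
        ∑ x : ZMod q, χ x * (e (A * x) * (e x) ^ n) := by
      intro n _
      have := gaussSum_mulShift_of_isPrimitive e hp ((A + n : ℕ) : ZMod q)
      rw [hquad.inv] at this
      rw [mul_comm, ← this, gaussSum]
      refine Finset.sum_congr rfl fun x _ => ?_
      rw [AddChar.mulShift_apply]
      congr 1
      push_cast
      rw [add_mul, AddChar.map_add_eq_mul, ← AddChar.map_nsmul_eq_pow, nsmul_eq_mul]
    rw [Finset.sum_congr rfl this, Finset.sum_comm]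
    refine Finset.sum_congr rfl fun x _ => ?_
    rw [Finset.mul_sum, Finset.mul_sum]
  have hb : ‖∑ x : ZMod q, χ x * (e (A * x) * ∑ n ∈ Finset.range H, (e x) ^ n)‖ ≤
      ∑ v ∈ Finset.Ico 1 q, (q : ℝ) / 2 * (1 / v + 1 / ((q - v : ℕ) : ℝ)) := by
    refine (norm_sum_le _ _).trans ?_
    have hinj : ∑ x : ZMod q, ‖χ x * (e (A * x) * ∑ n ∈ Finset.range H, (e x) ^ n)‖ =
        ∑ v ∈ Finset.range q, ‖χ (v : ZMod q) * (e (A * (v : ZMod q)) *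
          ∑ n ∈ Finset.range H, (e (v : ZMod q)) ^ n)‖ := by
      symm
      refine Finset.sum_bij (fun v _ => (v : ZMod q)) (fun _ _ => Finset.mem_univ _) ?_ ?_ ?_
      · intro a ha b hb hab
        rw [ZMod.natCast_eq_natCast_iff] at hab
        exact Nat.ModEq.eq_of_lt_of_lt hab (Finset.mem_range.mp ha) (Finset.mem_range.mp hb)
      · intro x _
        exact ⟨x.val, Finset.mem_range.mpr (ZMod.val_lt x), by simp⟩
      · intros; rfl
    rw [hinj, Finset.range_eq_Ico, Finset.sum_eq_sum_Ico_succ_bot (by omega)]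
    have h0 : χ ((0 : ℕ) : ZMod q) = 0 := by
      have : Fact (1 < q) := ⟨h1⟩
      rw [Nat.cast_zero]
      exact MulChar.map_zero χ
    rw [h0]
    simp only [zero_mul, norm_zero, zero_add]
    refine Finset.sum_le_sum fun v hv => ?_
    rw [Finset.mem_Ico] at hv
    have hev : e (v : ZMod q) = Complex.exp (2 * Real.pi * Complex.I * v / q) := by
      have := ZMod.stdAddChar_coe (N := q) (v : ℤ)
      simpa using this
    rw [norm_mul, norm_mul]
    have n1 : ‖χ (v : ZMod q)‖ ≤ 1 := DirichletCharacter.norm_le_one χ _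
    have n2 : ‖e (A * (v : ZMod q))‖ = 1 := by rw [he, ZMod.stdAddChar_apply]; exact Circle.norm_coe _
    rw [n2, one_mul, hev]
    have := norm_geom_le q v H (by omega) hv.2
    calc _ ≤ 1 * _ := mul_le_mul_of_nonneg_right n1 (norm_nonneg _)
      _ ≤ _ := by rw [one_mul]; exact this
  have hsum : ∑ v ∈ Finset.Ico 1 q, (q : ℝ) / 2 * (1 / v + 1 / ((q - v : ℕ) : ℝ)) ≤
      q * (1 + Real.log q) := by
    rw [← Finset.mul_sum, Finset.sum_add_distrib]
    have hrefl : ∑ v ∈ Finset.Ico 1 q, (1 : ℝ) / ((q - v : ℕ) : ℝ) =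
        ∑ v ∈ Finset.Ico 1 q, (1 : ℝ) / v := by
      refine Finset.sum_bij' (fun v _ => q - v) (fun v _ => q - v) ?_ ?_ ?_ ?_ ?_ <;>
        simp only [Finset.mem_Ico] <;> intros <;> first | omega | trivial
    rw [hrefl]
    have := sum_inv_le_log q
    have hq : (0 : ℝ) ≤ q := Nat.cast_nonneg _
    nlinarith
  have := hb.trans hsum
  rw [← key, norm_mul, hτs] at this
  have hq : (0 : ℝ) < Real.sqrt q := Real.sqrt_pos.mpr (by exact_mod_cast (by omega : 0 < q))
  have hqq : (q : ℝ) = Real.sqrt q * Real.sqrt q := (Real.mul_self_sqrt (Nat.cast_nonneg _)).symm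
  refine le_of_mul_le_mul_left (this.trans (le_of_eq ?_)) hq
  rw [← mul_assoc, ← hqq]

/-- Real valued Jacobi symbol -/
noncomputable def J (n m : ℕ) : ℝ := ((jacobiSym n m : ℤ) : ℝ)

lemma J_abs_le (n m : ℕ) : |J n m| ≤ 1 := by
  unfold J
  rcases jacobiSym.trichotomy (n : ℤ) m with h | h | h <;> simp [h]

lemma J_PV (q : ℕ) (h1 : 1 < q) (hq : Odd q) (hs : Squarefree q) (A H : ℕ) :
    |∑ n ∈ Finset.range H, J (A + n) q| ≤ Real.sqrt q * (1 + Real.log q) := by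
  have : NeZero q := ⟨by omega⟩
  have h := polya_vinogradov q h1 (jchar q) (jchar_primitive q hq hs) (jchar_quadratic q)
    (jchar_ne_one q hq hs h1) A H
  refine le_trans (le_of_eq ?_) h
  rw [← Real.norm_eq_abs, ← Complex.norm_real]
  congr 1
  push_cast
  refine Finset.sum_congr rfl fun n _ => ?_
  have := jchar_natCast q (A + n)
  push_cast at this
  rw [this, J]; push_cast; rfl


lemma moebius_indicator (g : ℕ) (hg : g ≠ 0) :
    ∑ e ∈ g.divisors, ((ArithmeticFunction.moebius e : ℤ) : ℝ) = if g = 1 then 1 else 0 := by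
  have h : (ArithmeticFunction.zeta * ArithmeticFunction.moebius : ArithmeticFunction ℤ) g =
      (1 : ArithmeticFunction ℤ) g := by
    rw [ArithmeticFunction.coe_zeta_mul_moebius]
  rw [ArithmeticFunction.coe_zeta_mul_apply, ArithmeticFunction.one_apply] at h
  rw [← Int.cast_sum, h]
  split_ifs <;> simp

lemma J_mul_left (a b m : ℕ) : J (a * b) m = J a m * J b m := by
  unfold J; push_cast; rw [jacobiSym.mul_left]; push_cast; rfl

lemma J_mul_right (a m n : ℕ) (hm : m ≠ 0) (hn : n ≠ 0) : J a (m * n) = J a m * J a n := by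
  have : NeZero m := ⟨hm⟩
  have : NeZero n := ⟨hn⟩
  unfold J; rw [jacobiSym.mul_right]; push_cast; rfl

lemma J_congr {a b m : ℕ} (h : a ≡ b [MOD m]) : J a m = J b m := by
  unfold J
  rw [jacobiSym.mod_left (a := (a : ℤ)), jacobiSym.mod_left (a := (b : ℤ))]
  have : (a : ℤ) % m = (b : ℤ) % m := by exact_mod_cast h
  rw [this]

lemma J_eq_zero {a m : ℕ} (hm : m ≠ 0) (h : ¬ Nat.Coprime a m) : J a m = 0 := by
  have : NeZero m := ⟨hm⟩
  unfold J
  rw [Int.cast_eq_zero, jacobiSym.eq_zero_iff_not_coprime, Int.gcd_natCast_natCast]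
  exact h

lemma J_sq_one {a m : ℕ} (h : Nat.Coprime a m) : J a m ^ 2 = 1 := by
  unfold J
  exact_mod_cast jacobiSym.sq_one (a := (a : ℤ)) (b := m) (by rwa [Int.gcd_natCast_natCast])

lemma J_PV_Ico (q : ℕ) (h1 : 1 < q) (hq : Odd q) (hs : Squarefree q) (A B : ℕ) :
    |∑ n ∈ Finset.Ico A B, J n q| ≤ Real.sqrt q * (1 + Real.log q) := by
  rw [Finset.sum_Ico_eq_sum_range]
  exact J_PV q h1 hq hs A (B - A)

lemma J_PV_coprime (q : ℕ) (h1 : 1 < q) (hq : Odd q) (hs : Squarefree q) (f : ℕ) (hf : f ≠ 0)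
    (A B : ℕ) :
    |∑ n ∈ Finset.Ico A B, if Nat.Coprime n f then J n q else 0| ≤
      f * (Real.sqrt q * (1 + Real.log q)) := by
  have hind : ∀ n : ℕ, (if Nat.Coprime n f then J n q else 0) =
      ∑ e ∈ f.divisors, if e ∣ n then ((ArithmeticFunction.moebius e : ℤ) : ℝ) * J n q else 0 := by
    intro n
    have hg : Nat.gcd n f ≠ 0 := Nat.gcd_ne_zero_right hf
    have h2 := moebius_indicator _ hg
    have h3 : (Nat.gcd n f).divisors = f.divisors.filter (fun e => e ∣ n) := by
      ext e
      simp only [Nat.mem_divisors, Finset.mem_filter, Nat.dvd_gcd_iff]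
      tauto
    rw [h3] at h2
    rw [← Finset.sum_filter, ← Finset.sum_mul, h2]
    unfold Nat.Coprime
    split_ifs <;> simp
  have hinner : ∀ e ∈ f.divisors, |∑ n ∈ Finset.Ico A B,
      (if e ∣ n then ((ArithmeticFunction.moebius e : ℤ) : ℝ) * J n q else 0)| ≤
      Real.sqrt q * (1 + Real.log q) := by
    intro e he
    have he0 : 0 < e := Nat.pos_of_mem_divisors he
    have : ∑ n ∈ Finset.Ico A B,
      (if e ∣ n then ((ArithmeticFunction.moebius e : ℤ) : ℝ) * J n q else 0) =
      ((ArithmeticFunction.moebius e : ℤ) : ℝ) * J e q *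
        ∑ n ∈ Finset.Ico (A ⌈/⌉ e) (B ⌈/⌉ e), J n q := by
      rw [← Finset.sum_filter, Finset.mul_sum]
      symm
      refine Finset.sum_bij (fun n _ => e * n) ?_ ?_ ?_ ?_
      · intro n hn
        rw [Finset.mem_Ico, ceilDiv_le_iff_le_mul he0, ← not_le, ceilDiv_le_iff_le_mul he0,
          not_le] at hn
        simp [hn]
      · intro a _ b _ hab
        exact Nat.eq_of_mul_eq_mul_left he0 hab
      · intro n hn
        rw [Finset.mem_filter, Finset.mem_Ico] at hn
        obtain ⟨⟨h1, h2⟩, k, rfl⟩ := hn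
        refine ⟨k, ?_, rfl⟩
        rw [Finset.mem_Ico, ceilDiv_le_iff_le_mul he0, ← not_le, ceilDiv_le_iff_le_mul he0, not_le]
        exact ⟨h1, h2⟩
      · intro n _
        rw [J_mul_left]; ring
    rw [this, abs_mul, abs_mul]
    have hm : |((ArithmeticFunction.moebius e : ℤ) : ℝ)| ≤ 1 := by
      exact_mod_cast ArithmeticFunction.abs_moebius_le_one (n := e)
    have hj := J_abs_le e q
    have hpv := J_PV_Ico q h1 hq hs (A ⌈/⌉ e) (B ⌈/⌉ e)
    calc _ ≤ 1 * |∑ n ∈ Finset.Ico (A ⌈/⌉ e) (B ⌈/⌉ e), J n q| := by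
          apply mul_le_mul_of_nonneg_right _ (abs_nonneg _)
          exact mul_le_one₀ hm (abs_nonneg _) hj
      _ ≤ _ := by rw [one_mul]; exact hpv
  rw [Finset.sum_congr rfl (fun n _ => hind n), Finset.sum_comm]
  refine (Finset.abs_sum_le_sum_abs _ _).trans ((Finset.sum_le_sum hinner).trans ?_)
  rw [Finset.sum_const, nsmul_eq_mul]
  apply mul_le_mul_of_nonneg_right
  · exact_mod_cast Nat.card_divisors_le_self f
  · have : 0 ≤ Real.log q := Real.log_natCast_nonneg q
    positivity

lemma J_PV_nonsquare (m : ℕ) (hm : Odd m) (hns : ¬ IsSquare m) (A B : ℕ) :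
    |∑ n ∈ Finset.Ico A B, J n m| ≤ Real.sqrt m * (1 + Real.log m) := by
  obtain ⟨q, f, hqf, hs⟩ := Nat.sq_mul_squarefree m
  have hq0 : q ≠ 0 := hs.ne_zero
  have hm0 : m ≠ 0 := by rintro rfl; simp at hm
  have hf0 : f ≠ 0 := by rintro rfl; apply hm0; rw [← hqf]; ring
  have hq1 : 1 < q := by
    rcases Nat.lt_or_ge 1 q with h | h
    · exact h
    · exfalso; apply hns
      have : q = 1 := by omega
      rw [← hqf, this, mul_one]
      exact ⟨f, by ring⟩
  have hqo : Odd q := by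
    rw [← hqf, Nat.odd_mul] at hm; exact hm.2
  have h := J_PV_coprime q hq1 hqo hs f hf0 A B
  have e : ∀ n, J n m = if Nat.Coprime n f then J n q else 0 := by
    intro n
    rw [← hqf, pow_two, J_mul_right _ _ _ (mul_ne_zero hf0 hf0) hq0, J_mul_right _ _ _ hf0 hf0]
    split_ifs with hc
    · have := J_sq_one hc
      rw [← pow_two, this, one_mul]
    · rw [J_eq_zero hf0 hc]; simp
  rw [Finset.sum_congr rfl (fun n _ => e n)]
  refine h.trans ?_
  have hsq : Real.sqrt m = f * Real.sqrt q := by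
    rw [← hqf]; push_cast
    rw [Real.sqrt_mul (by positivity), Real.sqrt_sq (by positivity)]
  rw [hsq, ← mul_assoc]
  apply mul_le_mul_of_nonneg_left _ (by positivity)
  have : Real.log q ≤ Real.log m := by
    apply Real.log_le_log (by exact_mod_cast (by omega : 0 < q))
    rw [← hqf]
    exact_mod_cast Nat.le_mul_of_pos_left q (by positivity)
  linarith

/-- sums over arithmetic progressions -/
lemma J_PV_AP (m : ℕ) (hm : Odd m) (hns : ¬ IsSquare m) (a W K : ℕ) (hW : Nat.Coprime W m) :
    |∑ k ∈ Finset.range K, J (a + W * k) m| ≤ Real.sqrt m * (1 + Real.log m) := by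
  have hm0 : m ≠ 0 := by rintro rfl; simp at hm
  have hm1 : 1 < m := by
    rcases Nat.lt_or_ge 1 m with h | h
    · exact h
    · exfalso; apply hns
      have : m = 1 := by omega
      rw [this]; exact ⟨1, rfl⟩
  obtain ⟨w, -, hw⟩ := Nat.exists_mul_mod_eq_one_of_coprime hW hm1
  have hw' : W * w ≡ 1 [MOD m] := by
    rw [Nat.ModEq, hw, Nat.mod_eq_of_lt hm1]
  have hc : ∀ k, J (a + W * k) m = J W m * J (w * a + k) m := by
    intro k
    rw [← J_mul_left]
    apply J_congr
    have : W * (w * a + k) = (W * w) * a + W * k := by ring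
    rw [this]
    apply Nat.ModEq.add_right
    simpa using (hw'.mul_right a).symm
  rw [Finset.sum_congr rfl (fun k _ => hc k), ← Finset.mul_sum, abs_mul]
  have h := J_PV_nonsquare m hm hns (w * a) (w * a + K)
  rw [Finset.sum_Ico_eq_sum_range, Nat.add_sub_cancel_left] at h
  calc _ ≤ 1 * |∑ k ∈ Finset.range K, J (w * a + k) m| :=
        mul_le_mul_of_nonneg_right (J_abs_le _ _) (abs_nonneg _)
    _ ≤ _ := by rw [one_mul]; exact h


lemma sum_inv_sq_tail (z t : ℕ) (hz : 1 ≤ z) :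
    ∑ g ∈ Finset.Ioc z t, (1 : ℝ) / (g : ℝ) ^ 2 ≤ 1 / z := by
  have key : ∀ t, z ≤ t → ∑ g ∈ Finset.Ioc z t, (1 : ℝ) / (g : ℝ) ^ 2 ≤ 1 / z - 1 / t := by
    intro t ht
    induction t, ht using Nat.le_induction with
    | base => simp
    | succ n hn ih =>
      have hn0 : (0 : ℝ) < n := by exact_mod_cast (by omega : 0 < n)
      rw [Finset.sum_Ioc_succ_top (by omega)]
      have : (1 : ℝ) / ((n + 1 : ℕ) : ℝ) ^ 2 ≤ 1 / n - 1 / ((n + 1 : ℕ) : ℝ) := by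
        push_cast
        rw [div_sub_div _ _ (by positivity) (by positivity), div_le_div_iff₀ (by positivity) (by positivity)]
        nlinarith
      linarith
  rcases le_total z t with h | h
  · have h1 := key t h
    have : (0 : ℝ) ≤ 1 / t := by positivity
    linarith
  · rw [Finset.Ioc_eq_empty (by omega)]
    simp

lemma sum_inv_sq_all (t : ℕ) : ∑ g ∈ Finset.Icc 1 t, (1 : ℝ) / (g : ℝ) ^ 2 ≤ 2 := by
  rcases Nat.eq_zero_or_pos t with h | h
  · subst h; simp
  rw [← Finset.add_sum_Ioc_eq_sum_Icc (by omega)]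
  have := sum_inv_sq_tail 1 t le_rfl
  norm_num at this ⊢
  linarith

lemma sum_inv_sqrt (t : ℕ) : ∑ n ∈ Finset.Icc 1 t, (1 : ℝ) / Real.sqrt n ≤ 2 * Real.sqrt t := by
  induction t with
  | zero => simp
  | succ n ih =>
    rw [Finset.sum_Icc_succ_top (by omega)]
    have h1 : 0 < Real.sqrt ((n + 1 : ℕ) : ℝ) := Real.sqrt_pos.mpr (by positivity)
    have h2 : 0 ≤ Real.sqrt (n : ℝ) := Real.sqrt_nonneg _
    have e1 : Real.sqrt ((n + 1 : ℕ) : ℝ) ^ 2 = n + 1 := by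
      rw [Real.sq_sqrt (by positivity)]; push_cast; rfl
    have e2 : Real.sqrt (n : ℝ) ^ 2 = n := Real.sq_sqrt (by positivity)
    have : 1 / Real.sqrt ((n + 1 : ℕ) : ℝ) ≤
        2 * Real.sqrt ((n + 1 : ℕ) : ℝ) - 2 * Real.sqrt (n : ℝ) := by
      rw [div_le_iff₀ h1]
      nlinarith [sq_nonneg (Real.sqrt ((n + 1 : ℕ) : ℝ) - Real.sqrt (n : ℝ))]
    linarith

lemma gt_of_coprime {z W g : ℕ} (hW : ∀ p : ℕ, p.Prime → p ≤ z → p ∣ W) (hg : Nat.Coprime g W)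
    (h1 : g ≠ 1) (h0 : g ≠ 0) : z < g := by
  have hp := Nat.minFac_prime h1
  by_contra h
  have h2 : g.minFac ≤ z := (Nat.minFac_le (by omega)).trans (by omega)
  have h3 := Nat.dvd_gcd (Nat.minFac_dvd g) (hW _ hp h2)
  rw [hg] at h3
  exact hp.one_lt.ne' (Nat.dvd_one.mp h3)

lemma sqfree_eq_of_mul_square {s1 s2 b1 b2 : ℕ} (h1 : Squarefree s1) (h2 : Squarefree s2)
    (hb1 : b1 ≠ 0) (hb2 : b2 ≠ 0) (h : IsSquare ((b1 ^ 2 * s1) * (b2 ^ 2 * s2))) : s1 = s2 := by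
  obtain ⟨c, hc⟩ := h
  have hd : b1 * b2 ∣ c := by
    rw [← Nat.pow_dvd_pow_iff two_ne_zero]
    exact ⟨s1 * s2, by rw [pow_two c, ← hc]; ring⟩
  obtain ⟨e, rfl⟩ := hd
  have hpos : 0 < (b1 * b2) ^ 2 := by positivity
  have he : s1 * s2 = e ^ 2 := by
    apply Nat.eq_of_mul_eq_mul_left hpos
    linarith [hc, show (b1 * b2) ^ 2 * (s1 * s2) = b1 ^ 2 * s1 * (b2 ^ 2 * s2) by ring,
      show (b1 * b2) ^ 2 * e ^ 2 = b1 * b2 * e * (b1 * b2 * e) by ring]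
  have h3 : s1 ∣ e := (h1.dvd_pow_iff_dvd two_ne_zero).mp ⟨s2, he.symm⟩
  obtain ⟨r, rfl⟩ := h3
  have h4 : s2 = s1 * (r * r) := by
    apply Nat.eq_of_mul_eq_mul_left (Nat.pos_of_ne_zero h1.ne_zero)
    rw [he]; ring
  have h5 : r * r ∣ s2 := ⟨s1, by rw [h4]; ring⟩
  have h6 := Nat.isUnit_iff.mp (h2 r h5)
  rw [h4, h6]; simp

/-- The set of `2 ≤ n ≤ t` coprime to `W`. -/
def TT (W t : ℕ) : Finset ℕ := (Finset.Icc 2 t).filter (fun n => Nat.Coprime n W)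

lemma diag_le (z W t : ℕ) (hz : 1 ≤ z) (hW : ∀ p : ℕ, p.Prime → p ≤ z → p ∣ W) :
    ∑ x ∈ (TT W t ×ˢ TT W t).filter (fun x => IsSquare (x.1 * x.2)),
      (1 : ℝ) / ((x.1 : ℝ) * x.2) ≤ 12 / z := by
  choose s b hb hs using Nat.sq_mul_squarefree
  set P := (TT W t ×ˢ TT W t).filter (fun x => IsSquare (x.1 * x.2)) with hP
  set F : ℕ × ℕ → ℕ × ℕ × ℕ := fun x => (s x.1, b x.1, b x.2) with hF
  have hTT : ∀ n ∈ TT W t, 2 ≤ n ∧ n ≤ t ∧ Nat.Coprime n W := by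
    intro n hn
    rw [TT, Finset.mem_filter, Finset.mem_Icc] at hn
    exact ⟨hn.1.1, hn.1.2, hn.2⟩
  have hb0 : ∀ n, n ≠ 0 → b n ≠ 0 := by
    intro n hn h
    have := hb n
    rw [h] at this; simp at this; omega
  have hPm : ∀ x ∈ P, x.1 ∈ TT W t ∧ x.2 ∈ TT W t ∧ s x.1 = s x.2 := by
    intro x hx
    rw [hP, Finset.mem_filter, Finset.mem_product] at hx
    refine ⟨hx.1.1, hx.1.2, ?_⟩
    have h1 := hTT _ hx.1.1
    have h2 := hTT _ hx.1.2
    refine sqfree_eq_of_mul_square (hs _) (hs _) (hb0 x.1 (by omega)) (hb0 x.2 (by omega)) ?_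
    rw [hb, hb]; exact hx.2
  have hinj : Set.InjOn F P := by
    intro x hx y hy hxy
    have hx' := hPm x hx
    have hy' := hPm y hy
    simp only [hF, Prod.mk.injEq] at hxy
    apply Prod.ext
    · rw [← hb x.1, ← hb y.1, hxy.1, hxy.2.1]
    · rw [← hb x.2, ← hb y.2, ← hx'.2.2, ← hy'.2.2, hxy.1, hxy.2.2]
  set w : ℕ → ℝ := fun g => (1 : ℝ) / (g : ℝ) ^ 2 with hw
  set v : ℕ → ℝ := fun g => if z < g then (1 : ℝ) / (g : ℝ) ^ 2 else 0 with hv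
  have hw0 : ∀ g, 0 ≤ w g := fun g => by simp only [hw]; positivity
  have hv0 : ∀ g, 0 ≤ v g := fun g => by simp only [hv]; split_ifs <;> positivity
  set R := Finset.Icc 1 t with hR
  set G : ℕ × ℕ × ℕ → ℝ := fun y => v y.1 * (w y.2.1 * w y.2.2) + w y.1 * (v y.2.1 * w y.2.2)
    + w y.1 * (w y.2.1 * v y.2.2) with hG
  have hG0 : ∀ y, 0 ≤ G y := by
    intro y
    have := hw0 y.1; have := hw0 y.2.1; have := hw0 y.2.2
    have := hv0 y.1; have := hv0 y.2.1; have := hv0 y.2.2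
    simp only [hG]; positivity
  have step1 : ∀ x ∈ P, (1 : ℝ) / ((x.1 : ℝ) * x.2) ≤ G (F x) := by
    intro x hx
    obtain ⟨hx1, hx2, hss⟩ := hPm x hx
    have t1 := hTT _ hx1
    have t2 := hTT _ hx2
    have hval : (1 : ℝ) / ((x.1 : ℝ) * x.2) = w (s x.1) * (w (b x.1) * w (b x.2)) := by
      conv_lhs => rw [← hb x.1, ← hb x.2, ← hss]
      simp only [hw]; push_cast
      rw [div_mul_div_comm, div_mul_div_comm]
      congr 1
      · ring
      · ring
    have big : z < s x.1 ∨ z < b x.1 := by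
      by_cases hs1 : s x.1 = 1
      · right
        apply gt_of_coprime hW _ _ (hb0 _ (by omega))
        · exact Nat.Coprime.coprime_dvd_left ((dvd_pow_self _ two_ne_zero).trans (Dvd.intro _ (hb x.1))) t1.2.2
        · intro h
          have := hb x.1
          rw [hs1, h] at this; omega
      · left
        apply gt_of_coprime hW _ hs1 (hs _).ne_zero
        exact Nat.Coprime.coprime_dvd_left (Dvd.intro_left _ (hb x.1)) t1.2.2
    rw [hval]
    have := hw0 (s x.1); have := hw0 (b x.1); have := hw0 (b x.2)
    have := hv0 (s x.1); have := hv0 (b x.1); have := hv0 (b x.2)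
    have e3 : 0 ≤ w (s x.1) * (w (b x.1) * v (b x.2)) := by positivity
    have e2 : 0 ≤ w (s x.1) * (v (b x.1) * w (b x.2)) := by positivity
    have e1 : 0 ≤ v (s x.1) * (w (b x.1) * w (b x.2)) := by positivity
    simp only [hG, hF]
    rcases big with h | h
    · have : v (s x.1) = w (s x.1) := by simp only [hv, hw, if_pos h]
      rw [this] at e1 ⊢; linarith
    · have : v (b x.1) = w (b x.1) := by simp only [hv, hw, if_pos h]
      rw [this] at e2 ⊢; linarith
  have step2 : ∑ x ∈ P, G (F x) ≤ ∑ y ∈ R ×ˢ R ×ˢ R, G y := by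
    rw [← Finset.sum_image (f := G) hinj]
    apply Finset.sum_le_sum_of_subset_of_nonneg
    · intro y hy
      rw [Finset.mem_image] at hy
      obtain ⟨x, hx, rfl⟩ := hy
      obtain ⟨hx1, hx2, hss⟩ := hPm x hx
      have t1 := hTT _ hx1
      have t2 := hTT _ hx2
      have d1 : s x.1 ∣ x.1 := (Dvd.intro_left _ (hb x.1))
      have d2 : b x.1 ∣ x.1 := ((dvd_pow_self _ two_ne_zero).trans (Dvd.intro _ (hb x.1)))
      have d3 : b x.2 ∣ x.2 := ((dvd_pow_self _ two_ne_zero).trans (Dvd.intro _ (hb x.2)))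
      have l1 := Nat.le_of_dvd (by omega) d1
      have l2 := Nat.le_of_dvd (by omega) d2
      have l3 := Nat.le_of_dvd (by omega) d3
      have p1 := Nat.pos_of_dvd_of_pos d1 (by omega)
      have p2 := Nat.pos_of_dvd_of_pos d2 (by omega)
      have p3 := Nat.pos_of_dvd_of_pos d3 (by omega)
      simp only [hF, hR, Finset.mem_product, Finset.mem_Icc]
      omega
    · intros; exact hG0 _
  have hsw : ∑ g ∈ R, w g ≤ 2 := sum_inv_sq_all t
  have hsv : ∑ g ∈ R, v g ≤ 1 / z := by
    rw [← Finset.sum_filter]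
    refine le_trans (le_of_eq ?_) (sum_inv_sq_tail z t hz)
    apply Finset.sum_congr _ (fun _ _ => rfl)
    ext g; simp [hR]; omega
  have hsw0 : 0 ≤ ∑ g ∈ R, w g := Finset.sum_nonneg fun g _ => hw0 g
  have hsv0 : 0 ≤ ∑ g ∈ R, v g := Finset.sum_nonneg fun g _ => hv0 g
  have step3 : ∑ y ∈ R ×ˢ R ×ˢ R, G y = 3 * ((∑ g ∈ R, v g) * ((∑ g ∈ R, w g) * (∑ g ∈ R, w g))) := by
    simp only [hG]
    rw [Finset.sum_add_distrib, Finset.sum_add_distrib]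
    simp only [Finset.sum_product, ← Finset.mul_sum, ← Finset.sum_mul]
    ring
  calc _ ≤ ∑ x ∈ P, G (F x) := Finset.sum_le_sum step1
    _ ≤ _ := step2
    _ = _ := step3
    _ ≤ 3 * ((1 / z) * (2 * 2)) := by gcongr
    _ = _ := by ring

/-- truncated sum attached to the `k`-th member of the family -/
noncomputable def SS (a W k t : ℕ) : ℝ := ∑ n ∈ TT W t, J (a + W * k) n / n

lemma second_moment (z W a K t : ℕ) (hz : 2 ≤ z) (hW : ∀ p : ℕ, p.Prime → p ≤ z → p ∣ W)
    (ht : 1 ≤ t) :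
    ∑ k ∈ Finset.range K, SS a W k t ^ 2 ≤ K * (12 / z) + 4 * t * (1 + 2 * Real.log t) := by
  set T := TT W t with hT
  have hTT : ∀ n ∈ T, 2 ≤ n ∧ n ≤ t ∧ Nat.Coprime n W ∧ Odd n := by
    intro n hn
    rw [hT, TT, Finset.mem_filter, Finset.mem_Icc] at hn
    refine ⟨hn.1.1, hn.1.2, hn.2, ?_⟩
    have := Nat.Coprime.coprime_dvd_right (hW 2 Nat.prime_two hz) hn.2
    exact Nat.coprime_two_right.mp this
  have e1 : ∑ k ∈ Finset.range K, SS a W k t ^ 2 = ∑ x ∈ T ×ˢ T,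
      (1 / ((x.1 : ℝ) * x.2)) * ∑ k ∈ Finset.range K, J (a + W * k) (x.1 * x.2) := by
    have : ∀ k ∈ Finset.range K, SS a W k t ^ 2 = ∑ x ∈ T ×ˢ T,
        (1 / ((x.1 : ℝ) * x.2)) * J (a + W * k) (x.1 * x.2) := by
      intro k _
      rw [SS, pow_two, Finset.sum_mul_sum, ← Finset.sum_product']
      refine Finset.sum_congr rfl fun x hx => ?_
      rw [Finset.mem_product] at hx
      have h1 := hTT _ hx.1
      have h2 := hTT _ hx.2
      rw [J_mul_right _ _ _ (by omega) (by omega), div_mul_div_comm]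
      ring
    rw [Finset.sum_congr rfl this, Finset.sum_comm]
    refine Finset.sum_congr rfl fun x _ => ?_
    rw [Finset.mul_sum]
  set c : ℝ := 1 + 2 * Real.log t with hc
  have hlt : 0 ≤ Real.log t := Real.log_natCast_nonneg t
  have e2 : ∀ x ∈ T ×ˢ T,
      (1 / ((x.1 : ℝ) * x.2)) * ∑ k ∈ Finset.range K, J (a + W * k) (x.1 * x.2) ≤
      (if IsSquare (x.1 * x.2) then K * (1 / ((x.1 : ℝ) * x.2)) else 0) +
        c * ((1 / Real.sqrt x.1) * (1 / Real.sqrt x.2)) := by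
    intro x hx
    rw [Finset.mem_product] at hx
    have h1 := hTT _ hx.1
    have h2 := hTT _ hx.2
    have p1 : (0 : ℝ) < x.1 := by exact_mod_cast (by omega : 0 < x.1)
    have p2 : (0 : ℝ) < x.2 := by exact_mod_cast (by omega : 0 < x.2)
    have hnn : 0 ≤ c * ((1 / Real.sqrt x.1) * (1 / Real.sqrt x.2)) := by positivity
    split_ifs with hsq
    · have : ∑ k ∈ Finset.range K, J (a + W * k) (x.1 * x.2) ≤ K := by
        refine (Finset.sum_le_sum (g := fun _ => (1 : ℝ))
          fun k _ => (le_abs_self _).trans (J_abs_le _ _)).trans ?_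
        simp
      have := mul_le_mul_of_nonneg_left this (show 0 ≤ 1 / ((x.1 : ℝ) * x.2) by positivity)
      linarith [mul_comm (K : ℝ) (1 / ((x.1 : ℝ) * x.2))]
    · have hpv := J_PV_AP (x.1 * x.2) (h1.2.2.2.mul h2.2.2.2) hsq a W K
        (Nat.Coprime.mul_right h1.2.2.1.symm h2.2.2.1.symm)
      have hlog : 1 + Real.log ((x.1 * x.2 : ℕ) : ℝ) ≤ c := by
        rw [hc]; push_cast
        rw [Real.log_mul p1.ne' p2.ne']
        have l1 : Real.log x.1 ≤ Real.log t := Real.log_le_log p1 (by exact_mod_cast h1.2.1)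
        have l2 : Real.log x.2 ≤ Real.log t := Real.log_le_log p2 (by exact_mod_cast h2.2.1)
        linarith
      have h3 : ∑ k ∈ Finset.range K, J (a + W * k) (x.1 * x.2) ≤
          Real.sqrt x.1 * Real.sqrt x.2 * c := by
        refine (le_abs_self _).trans (hpv.trans ?_)
        rw [← Real.sqrt_mul p1.le]
        push_cast at hlog ⊢
        exact mul_le_mul_of_nonneg_left hlog (Real.sqrt_nonneg _)
      have := mul_le_mul_of_nonneg_left h3 (show 0 ≤ 1 / ((x.1 : ℝ) * x.2) by positivity)
      rw [zero_add]
      refine this.trans (le_of_eq ?_)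
      have q1 : 0 < Real.sqrt x.1 := Real.sqrt_pos.mpr p1
      have q2 : 0 < Real.sqrt x.2 := Real.sqrt_pos.mpr p2
      have s1 : (x.1 : ℝ) = Real.sqrt x.1 * Real.sqrt x.1 := (Real.mul_self_sqrt p1.le).symm
      have s2 : (x.2 : ℝ) = Real.sqrt x.2 * Real.sqrt x.2 := (Real.mul_self_sqrt p2.le).symm
      rw [show 1 / ((x.1 : ℝ) * x.2) = 1 / ((Real.sqrt x.1 * Real.sqrt x.1) *
        (Real.sqrt x.2 * Real.sqrt x.2)) by rw [← s1, ← s2]]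
      field_simp
  rw [e1]
  refine (Finset.sum_le_sum e2).trans ?_
  rw [Finset.sum_add_distrib]
  apply add_le_add
  · rw [← Finset.sum_filter, ← Finset.mul_sum]
    exact mul_le_mul_of_nonneg_left (diag_le z W t (by omega) hW) (Nat.cast_nonneg _)
  · rw [← Finset.mul_sum, Finset.sum_product' (f := fun x y : ℕ => (1 / Real.sqrt x) * (1 / Real.sqrt y)),
      ← Finset.sum_mul_sum]
    have hsub : ∑ n ∈ T, 1 / Real.sqrt n ≤ 2 * Real.sqrt t := by
      refine le_trans ?_ (sum_inv_sqrt t)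
      apply Finset.sum_le_sum_of_subset_of_nonneg
      · intro n hn
        have := hTT n hn
        rw [Finset.mem_Icc]; omega
      · intros; positivity
    have h0 : 0 ≤ ∑ n ∈ T, 1 / Real.sqrt (n : ℝ) := Finset.sum_nonneg fun _ _ => by positivity
    have hst : Real.sqrt t * Real.sqrt t = t := Real.mul_self_sqrt (Nat.cast_nonneg _)
    have hc0 : 0 ≤ c := by positivity
    calc c * ((∑ n ∈ T, 1 / Real.sqrt (n : ℝ)) * ∑ n ∈ T, 1 / Real.sqrt (n : ℝ)) ≤
        c * ((2 * Real.sqrt t) * (2 * Real.sqrt t)) := by gcongr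
      _ = 4 * (Real.sqrt t * Real.sqrt t) * c := by ring
      _ = 4 * t * c := by rw [hst]


lemma char_sum_bounded (q : ℕ) [NeZero q] (χ : DirichletCharacter ℂ q) (hχ : χ ≠ 1) (N : ℕ) :
    ‖∑ n ∈ Finset.range N, χ (n : ZMod q)‖ ≤ q := by
  have h0 : ∑ n ∈ Finset.range q, χ (n : ZMod q) = 0 := by
    rw [← MulChar.sum_eq_zero_of_ne_one hχ]
    refine Finset.sum_bij (fun n _ => (n : ZMod q)) (by simp) ?_ ?_ (by simp)
    · intro a ha b hb h
      rw [Finset.mem_range] at ha hb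
      have := congrArg ZMod.val h
      rwa [ZMod.val_natCast_of_lt ha, ZMod.val_natCast_of_lt hb] at this
    · intro b _
      exact ⟨b.val, Finset.mem_range.mpr (ZMod.val_lt b), ZMod.natCast_zmod_val b⟩
  have hper : ∀ m r, ∑ n ∈ Finset.range (q * m + r), χ (n : ZMod q) = ∑ n ∈ Finset.range r, χ (n : ZMod q) := by
    intro m r
    induction m with
    | zero => simp
    | succ m ih =>
      rw [show q * (m + 1) + r = q + (q * m + r) by ring, Finset.sum_range_add, h0, zero_add, ← ih]
      refine Finset.sum_congr rfl fun n _ => ?_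
      push_cast; simp
  rw [← Nat.div_add_mod N q, hper]
  refine (norm_sum_le _ _).trans ?_
  refine (Finset.sum_le_sum (g := fun _ => (1 : ℝ)) fun n _ => DirichletCharacter.norm_le_one χ _).trans ?_
  simp
  exact_mod_cast (Nat.mod_lt N (Nat.pos_of_ne_zero (NeZero.ne q))).le

/-- partial sums of the Dirichlet series -/
noncomputable def PS {q : ℕ} (χ : DirichletCharacter ℂ q) (s : ℂ) (N : ℕ) : ℂ :=
  ∑ n ∈ Finset.range N, χ ((n + 1 : ℕ) : ZMod q) * ((n + 1 : ℕ) : ℂ) ^ (-s)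

lemma cpow_diff_bound (s : ℂ) (hs : 0 < s.re) (n : ℕ) :
    ‖((n + 1 : ℕ) : ℂ) ^ (-s) - ((n + 2 : ℕ) : ℂ) ^ (-s)‖ ≤ ‖s‖ * ((n + 1 : ℕ) : ℝ) ^ (-s.re - 1) := by
  have hn : (0 : ℝ) < ((n + 1 : ℕ) : ℝ) := by positivity
  have hs0 : s ≠ 0 := by rintro rfl; simp at hs
  have key := Convex.norm_image_sub_le_of_norm_hasDerivWithin_le (𝕜 := ℝ)
    (f := fun x : ℝ => (x : ℂ) ^ (-s)) (f' := fun x : ℝ => (-s) * (x : ℂ) ^ (-s - 1))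
    (s := Set.Icc ((n + 1 : ℕ) : ℝ) ((n + 2 : ℕ) : ℝ)) (C := ‖s‖ * ((n + 1 : ℕ) : ℝ) ^ (-s.re - 1))
    (x := ((n + 2 : ℕ) : ℝ)) (y := ((n + 1 : ℕ) : ℝ)) ?_ ?_ (convex_Icc _ _) ?_ ?_
  · have e : ‖((n + 1 : ℕ) : ℝ) - ((n + 2 : ℕ) : ℝ)‖ = 1 := by push_cast; norm_num
    rw [e, mul_one] at key
    simpa using key
  · intro x hx
    have hx0 : 0 < x := lt_of_lt_of_le hn hx.1
    exact (hasDerivAt_ofReal_cpow_const hx0.ne' (neg_ne_zero.mpr hs0)).hasDerivWithinAt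
  · intro x hx
    have hx0 : 0 < x := lt_of_lt_of_le hn hx.1
    rw [norm_mul, norm_neg, Complex.norm_cpow_eq_rpow_re_of_pos hx0]
    have : (-s - 1).re = -s.re - 1 := by simp
    rw [this]
    exact mul_le_mul_of_nonneg_left (Real.rpow_le_rpow_of_nonpos hn hx.1 (by linarith)) (norm_nonneg _)
  · constructor <;> push_cast <;> linarith
  · constructor <;> push_cast <;> linarith

lemma PS_abel {q : ℕ} (χ : DirichletCharacter ℂ q) (s : ℂ) (N : ℕ) :
    PS χ s (N + 1) = ∑ n ∈ Finset.range N, (∑ k ∈ Finset.range (n + 1), χ ((k + 1 : ℕ) : ZMod q)) *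
      (((n + 1 : ℕ) : ℂ) ^ (-s) - ((n + 2 : ℕ) : ℂ) ^ (-s)) +
      (∑ k ∈ Finset.range (N + 1), χ ((k + 1 : ℕ) : ZMod q)) * ((N + 1 : ℕ) : ℂ) ^ (-s) := by
  induction N with
  | zero => simp [PS]
  | succ N ih =>
    have e1 : PS χ s (N + 1 + 1) = PS χ s (N + 1) + χ ((N + 1 + 1 : ℕ) : ZMod q) *
        ((N + 1 + 1 : ℕ) : ℂ) ^ (-s) := Finset.sum_range_succ _ _
    have e2 : ∑ k ∈ Finset.range (N + 1 + 1), χ ((k + 1 : ℕ) : ZMod q) =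
        ∑ k ∈ Finset.range (N + 1), χ ((k + 1 : ℕ) : ZMod q) + χ ((N + 1 + 1 : ℕ) : ZMod q) :=
      Finset.sum_range_succ _ _
    rw [e1, ih, e2, Finset.sum_range_succ (fun n => (∑ k ∈ Finset.range (n + 1), χ ((k + 1 : ℕ) : ZMod q)) *
      (((n + 1 : ℕ) : ℂ) ^ (-s) - ((n + 2 : ℕ) : ℂ) ^ (-s))) N]
    generalize ∑ k ∈ Finset.range (N + 1), χ ((k + 1 : ℕ) : ZMod q) = X
    simp only [show N + 1 + 1 = N + 2 from rfl]
    ring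

theorem PS_tendsto (q : ℕ) [NeZero q] (χ : DirichletCharacter ℂ q) (hχ : χ ≠ 1) (s : ℂ) (hs : 0 < s.re) :
    Tendsto (PS χ s) atTop (nhds (DirichletCharacter.LFunction χ s)) := by
  set A : ℕ → ℂ := fun n => ∑ k ∈ Finset.range n, χ ((k + 1 : ℕ) : ZMod q) with hA
  have hAb : ∀ n, ‖A n‖ ≤ q + 1 := by
    intro n
    have h1 := char_sum_bounded q χ hχ (n + 1)
    rw [Finset.sum_range_succ'] at h1
    have h2 : A n = (∑ k ∈ Finset.range n, χ ((k + 1 : ℕ) : ZMod q) + χ ((0 : ℕ) : ZMod q)) - χ ((0 : ℕ) : ZMod q) := by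
      simp [hA]
    rw [h2]
    exact (norm_sub_le _ _).trans (add_le_add h1 (DirichletCharacter.norm_le_one χ _))
  set F : ℕ → ℂ → ℂ := fun n w => A (n + 1) * (((n + 1 : ℕ) : ℂ) ^ (-w) - ((n + 2 : ℕ) : ℂ) ^ (-w)) with hF
  set δ := min (s.re / 2) 1 with hδ
  have hδ0 : 0 < δ := lt_min (by linarith) one_pos
  have hδs : δ < s.re := (min_le_left _ _).trans_lt (by linarith)
  set R := ‖s‖ + 3 with hR
  set U : Set ℂ := {w | δ < w.re} ∩ Metric.ball 0 R with hU
  have hUo : IsOpen U := (isOpen_lt continuous_const Complex.continuous_re).inter Metric.isOpen_ball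
  have hUc : Convex ℝ U := (convex_halfSpace_re_gt δ).inter (convex_ball _ _)
  set u : ℕ → ℝ := fun n => (q + 1) * (R * ((n + 1 : ℕ) : ℝ) ^ (-δ - 1)) with hu
  have hus : Summable u := by
    apply Summable.mul_left
    apply Summable.mul_left
    exact (summable_nat_add_iff (f := fun n : ℕ => (n : ℝ) ^ (-δ - 1)) 1).mpr
      (Real.summable_nat_rpow.mpr (by linarith))
  have hFu : ∀ n w, w ∈ U → ‖F n w‖ ≤ u n := by
    intro n w hw
    have hw1 : δ < w.re := hw.1
    have hw2 : ‖w‖ < R := by simpa using hw.2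
    rw [hF, hu]; dsimp only
    rw [norm_mul]
    refine mul_le_mul (hAb _) ?_ (norm_nonneg _) (by positivity)
    refine (cpow_diff_bound w (hδ0.trans hw1) n).trans ?_
    refine mul_le_mul hw2.le ?_ (by positivity) (by positivity)
    exact Real.rpow_le_rpow_of_exponent_le (by push_cast; linarith [Nat.cast_nonneg (α := ℝ) n]) (by linarith)
  have hFd : ∀ n, DifferentiableOn ℂ (F n) U := by
    intro n
    apply Differentiable.differentiableOn
    have h1 : ((n + 1 : ℕ) : ℂ) ≠ 0 := by exact_mod_cast Nat.succ_ne_zero n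
    have h2 : ((n + 2 : ℕ) : ℂ) ≠ 0 := by exact_mod_cast Nat.succ_ne_zero (n + 1)
    intro w
    have d1 : DifferentiableAt ℂ (fun w => ((n + 1 : ℕ) : ℂ) ^ (-w)) w :=
      (differentiableAt_id.neg).const_cpow (Or.inl h1)
    have d2 : DifferentiableAt ℂ (fun w => ((n + 2 : ℕ) : ℂ) ^ (-w)) w :=
      (differentiableAt_id.neg).const_cpow (Or.inl h2)
    exact (d1.sub d2).const_mul _
  set G : ℂ → ℂ := fun w => ∑' n, F n w with hG
  have hGd : DifferentiableOn ℂ G U := Complex.differentiableOn_tsum_of_summable_norm hus hFd hUo hFu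
  have hlim : ∀ w ∈ U, Tendsto (PS χ w) atTop (nhds (G w)) := by
    intro w hw
    have hw0 : 0 < w.re := hδ0.trans hw.1
    rw [← tendsto_add_atTop_iff_nat 1]
    have hsum : Summable fun n => F n w := Summable.of_norm_bounded hus (fun n => hFu n w hw)
    have t1 := hsum.hasSum.tendsto_sum_nat
    have t2 : Tendsto (fun N : ℕ => A (N + 1) * ((N + 1 : ℕ) : ℂ) ^ (-w)) atTop (nhds 0) := by
      have t3 : Tendsto (fun N : ℕ => ((q : ℝ) + 1) * ((N + 1 : ℕ) : ℝ) ^ (-w.re)) atTop (nhds 0) := by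
        rw [← mul_zero ((q : ℝ) + 1)]
        exact ((tendsto_rpow_neg_atTop hw0).comp
          (tendsto_natCast_atTop_atTop.comp (tendsto_add_atTop_nat 1))).const_mul _
      refine squeeze_zero_norm (fun N => ?_) t3
      rw [norm_mul]
      refine mul_le_mul (hAb _) (le_of_eq ?_) (norm_nonneg _) (by positivity)
      rw [show ((N + 1 : ℕ) : ℂ) = (((N + 1 : ℕ) : ℝ) : ℂ) by push_cast; rfl,
        Complex.norm_cpow_eq_rpow_re_of_pos (by positivity)]
      simp
    have := t1.add t2
    rw [add_zero] at this
    refine this.congr fun N => ?_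
    rw [PS_abel]
  have hconv : ∀ w : ℂ, 1 < w.re → Tendsto (PS χ w) atTop (nhds (DirichletCharacter.LFunction χ w)) := by
    intro w hw
    rw [DirichletCharacter.LFunction_eq_LSeries χ hw]
    have := (DirichletCharacter.LSeriesSummable_of_one_lt_re χ hw).hasSum.tendsto_sum_nat
    have t := (tendsto_add_atTop_iff_nat 1).mpr this
    refine t.congr fun N => ?_
    rw [Finset.sum_range_succ', LSeries.term_zero, add_zero, PS]
    refine Finset.sum_congr rfl fun n _ => ?_
    rw [LSeries.term_of_ne_zero (Nat.succ_ne_zero n), Complex.cpow_neg]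
    rfl
  have heq : Set.EqOn G (DirichletCharacter.LFunction χ) U := by
    have h2U : (2 : ℂ) ∈ U := by
      constructor
      · change δ < (2 : ℂ).re
        have : δ ≤ 1 := min_le_right _ _
        simp; linarith
      · rw [mem_ball_zero_iff, hR]; simp; linarith [norm_nonneg s]
    refine AnalyticOnNhd.eqOn_of_preconnected_of_eventuallyEq (z₀ := (2 : ℂ))
      (hGd.analyticOnNhd hUo)
      ((DirichletCharacter.differentiable_LFunction hχ).differentiableOn.analyticOnNhd hUo)
      hUc.isPreconnected h2U ?_
    have : {w : ℂ | 1 < w.re} ∩ U ∈ nhds (2 : ℂ) :=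
      ((isOpen_lt continuous_const Complex.continuous_re).inter hUo).mem_nhds ⟨by simp, h2U⟩
    filter_upwards [this] with w hw
    exact tendsto_nhds_unique (hlim w hw.2) (hconv w hw.1)
  have hsU : s ∈ U := ⟨hδs, by rw [mem_ball_zero_iff, hR]; linarith⟩
  rw [← heq hsU]
  exact hlim s hsU


lemma abel_ineq (x g : ℕ → ℝ) (C : ℝ) (A : ℕ) (hx : ∀ M, |∑ n ∈ Finset.Ico A M, x n| ≤ C)
    (hg : ∀ n, A ≤ n → g (n + 1) ≤ g n) (g0 : ∀ n, A ≤ n → 0 ≤ g n) (M : ℕ) :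
    |∑ n ∈ Finset.Ico A M, x n * g n| ≤ C * g A := by
  have hC : 0 ≤ C := (abs_nonneg _).trans (hx 0)
  have key : ∀ M, A ≤ M → |∑ n ∈ Finset.Ico A M, x n * g n - (∑ n ∈ Finset.Ico A M, x n) * g M| ≤
      C * (g A - g M) := by
    intro M hM
    induction M, hM using Nat.le_induction with
    | base => simp
    | succ n hn ih =>
      have e1 := Finset.sum_Ico_succ_top hn (fun n => x n * g n)
      have e2 := Finset.sum_Ico_succ_top hn x
      rw [e1]
      have e3 : ∑ k ∈ Finset.Ico A n, x k * g k + x n * g n - (∑ k ∈ Finset.Ico A (n + 1), x k) * g (n + 1)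
        = (∑ k ∈ Finset.Ico A n, x k * g k - (∑ k ∈ Finset.Ico A n, x k) * g n) +
          (∑ k ∈ Finset.Ico A (n + 1), x k) * (g n - g (n + 1)) := by
        rw [e2]; ring
      rw [e3]
      refine (abs_add_le _ _).trans ?_
      have e4 : |(∑ k ∈ Finset.Ico A (n + 1), x k) * (g n - g (n + 1))| ≤ C * (g n - g (n + 1)) := by
        rw [abs_mul, abs_of_nonneg (sub_nonneg.mpr (hg n hn))]
        exact mul_le_mul_of_nonneg_right (hx _) (sub_nonneg.mpr (hg n hn))
      linarith
  rcases le_total A M with h | h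
  · have h1 := key M h
    have h2 : |(∑ n ∈ Finset.Ico A M, x n) * g M| ≤ C * g M := by
      rw [abs_mul, abs_of_nonneg (g0 M h)]
      exact mul_le_mul_of_nonneg_right (hx _) (g0 M h)
    have h3 := abs_add_le (∑ n ∈ Finset.Ico A M, x n * g n - (∑ n ∈ Finset.Ico A M, x n) * g M)
      ((∑ n ∈ Finset.Ico A M, x n) * g M)
    rw [sub_add_cancel] at h3
    linarith
  · rw [Finset.Ico_eq_empty (by omega)]
    simp only [Finset.sum_empty, abs_zero]
    exact mul_nonneg hC (g0 A le_rfl)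

lemma sum_Ico_bdd (x : ℕ → ℝ) (B : ℝ) (hB : ∀ N, |∑ n ∈ Finset.range N, x n| ≤ B) (A M : ℕ) :
    |∑ n ∈ Finset.Ico A M, x n| ≤ 2 * B := by
  rcases le_total A M with h | h
  · rw [Finset.sum_Ico_eq_sub _ h]
    have := abs_sub (∑ k ∈ Finset.range M, x k) (∑ k ∈ Finset.range A, x k)
    linarith [hB A, hB M]
  · rw [Finset.Ico_eq_empty (by omega)]
    simp only [Finset.sum_empty, abs_zero]
    have := (abs_nonneg _).trans (hB 0)
    linarith

lemma range_of_Ico (u : ℕ → ℝ) (A : ℕ) (C : ℝ) (h : ∀ M, |∑ n ∈ Finset.Ico A M, u n| ≤ C) :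
    ∃ C', ∀ N, |∑ n ∈ Finset.range N, u n| ≤ C' := by
  refine ⟨∑ n ∈ Finset.range A, |u n| + C, fun N => ?_⟩
  have hC : 0 ≤ C := (abs_nonneg _).trans (h 0)
  rcases le_total A N with hh | hh
  · rw [← Finset.sum_range_add_sum_Ico _ hh]
    refine (abs_add_le _ _).trans (add_le_add (Finset.abs_sum_le_sum_abs _ _) (h N))
  · refine (Finset.abs_sum_le_sum_abs _ _).trans ?_
    have := Finset.sum_le_sum_of_subset_of_nonneg (Finset.range_subset_range.mpr hh)
      (fun n _ _ => abs_nonneg (u n))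
    linarith

lemma mertens_bound (x : ℕ →*₀ ℝ) (hx1 : ∀ n, |x n| ≤ 1) (B : ℝ)
    (hB : ∀ N, |∑ n ∈ Finset.range N, x n| ≤ B) (L : ℝ) (hL : L ≠ 0)
    (hlim : Tendsto (fun N => ∑ n ∈ Finset.range N, x n / n) atTop (nhds L)) :
    ∃ C, ∀ N, |∑ n ∈ Finset.range N, x n * ArithmeticFunction.vonMangoldt n / n| ≤ C := by
  have hB0 : 0 ≤ B := (abs_nonneg _).trans (hB 0)
  -- tail bound
  have htail : ∀ M : ℕ, |L - ∑ n ∈ Finset.range (M + 1), x n / n| ≤ 2 * B / ((M + 1 : ℕ) : ℝ) := by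
    intro M
    have h1 : Tendsto (fun N => |∑ n ∈ Finset.range N, x n / n - ∑ n ∈ Finset.range (M + 1), x n / n|) atTop
      (nhds |L - ∑ n ∈ Finset.range (M + 1), x n / n|) := (hlim.sub_const _).abs
    refine le_of_tendsto h1 ?_
    filter_upwards [eventually_ge_atTop (M + 1)] with N hN
    rw [← Finset.sum_Ico_eq_sub _ hN]
    have := abel_ineq x (fun n => 1 / (n : ℝ)) (2 * B) (M + 1) (sum_Ico_bdd x B hB (M + 1)) ?_ ?_ N
    · calc _ = |∑ n ∈ Finset.Ico (M + 1) N, x n * (1 / (n : ℝ))| := by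
            congr 1; exact Finset.sum_congr rfl fun n _ => by ring
        _ ≤ _ := this
        _ = _ := by ring
    · intro n hn
      have : (0 : ℝ) < n := by exact_mod_cast (by omega : 0 < n)
      apply one_div_le_one_div_of_le this; push_cast; linarith
    · intro n _; positivity
  -- log sum bounded
  obtain ⟨C1, hC1⟩ : ∃ C1, ∀ N, |∑ n ∈ Finset.range N, x n * (Real.log n / n)| ≤ C1 := by
    refine range_of_Ico _ 3 (2 * B * (Real.log (3 : ℕ) / (3 : ℕ))) ?_
    refine abel_ineq x (fun n => Real.log n / n) (2 * B) 3 (sum_Ico_bdd x B hB 3) ?_ ?_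
    · intro n hn
      have h3 : Real.exp 1 ≤ n := by
        have := Real.exp_one_lt_d9
        have : (3 : ℝ) ≤ n := by exact_mod_cast hn
        linarith
      exact Real.log_div_self_antitoneOn h3 (by simp only [Set.mem_Ici]; push_cast; linarith) (by push_cast; linarith)
    · intro n _
      exact div_nonneg (Real.log_natCast_nonneg n) (Nat.cast_nonneg n)
  refine ⟨(C1 + 2 * B * (Real.log 4 + 4)) / |L|, ?_⟩
  intro N0
  rcases Nat.eq_zero_or_pos N0 with h | h
  · subst h
    simp only [Finset.range_zero, Finset.sum_empty, abs_zero]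
    have := (abs_nonneg _).trans (hC1 0)
    have : 0 ≤ Real.log 4 := Real.log_nonneg (by norm_num)
    positivity
  obtain ⟨N, rfl⟩ : ∃ N, N0 = N + 1 := ⟨N0 - 1, by omega⟩
  have hr : ∀ (u : ℕ → ℝ) (N : ℕ), u 0 = 0 → ∑ n ∈ Finset.range (N + 1), u n = ∑ n ∈ Finset.Ioc 0 N, u n := by
    intro u N hu
    rw [Finset.range_eq_Ico, ← Finset.sum_erase (a := 0) _ hu]
    apply Finset.sum_congr _ (fun _ _ => rfl)
    ext n; simp
  set f : ArithmeticFunction ℝ := ⟨fun n => x n * ArithmeticFunction.vonMangoldt n / n, by simp⟩ with hf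
  set g : ArithmeticFunction ℝ := ⟨fun n => x n / n, by simp⟩ with hg
  have hfg : ∀ n, (f * g) n = x n * (Real.log n / n) := by
    intro n
    rw [ArithmeticFunction.mul_apply, ← ArithmeticFunction.vonMangoldt_sum, ← Nat.sum_divisorsAntidiagonal (f := fun i _ => (ArithmeticFunction.vonMangoldt i : ℝ)),
      Finset.sum_div, Finset.mul_sum]
    refine Finset.sum_congr rfl fun y hy => ?_
    rw [Nat.mem_divisorsAntidiagonal] at hy
    obtain ⟨rfl, h0⟩ := hy
    simp only [hf, hg, ArithmeticFunction.coe_mk, map_mul]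
    push_cast
    rw [div_mul_div_comm]; ring
  have hmain := ArithmeticFunction.sum_Ioc_mul_eq_sum_sum f g N
  simp only [hfg] at hmain
  have hl : L * ∑ n ∈ Finset.range (N + 1), x n * ArithmeticFunction.vonMangoldt n / n =
      ∑ n ∈ Finset.Ioc 0 N, x n * (Real.log n / n) +
      ∑ n ∈ Finset.Ioc 0 N, f n * (L - ∑ m ∈ Finset.Ioc 0 (N / n), g m) := by
    rw [hmain, ← Finset.sum_add_distrib, hr _ _ (by simp), Finset.mul_sum]
    refine Finset.sum_congr rfl fun n _ => ?_
    simp only [hf, ArithmeticFunction.coe_mk]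
    ring
  have hN1 : |∑ n ∈ Finset.Ioc 0 N, x n * (Real.log n / n)| ≤ C1 := by
    rw [← hr _ _ (by simp)]; exact hC1 _
  have hN2 : |∑ n ∈ Finset.Ioc 0 N, f n * (L - ∑ m ∈ Finset.Ioc 0 (N / n), g m)| ≤ 2 * B * (Real.log 4 + 4) := by
    rcases Nat.eq_zero_or_pos N with hN | hN
    · subst hN; simp; have : 0 ≤ Real.log 4 := Real.log_nonneg (by norm_num)
      positivity
    have hNr : (0 : ℝ) < N := by exact_mod_cast hN
    have hb : ∀ n ∈ Finset.Ioc 0 N, |f n * (L - ∑ m ∈ Finset.Ioc 0 (N / n), g m)| ≤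
        2 * B / N * ArithmeticFunction.vonMangoldt n := by
      intro n hn
      rw [Finset.mem_Ioc] at hn
      have hn0 : (0 : ℝ) < n := by exact_mod_cast hn.1
      have ht := htail (N / n)
      have e : ∑ m ∈ Finset.range (N / n + 1), x m / m = ∑ m ∈ Finset.Ioc 0 (N / n), g m := by
        rw [hr _ _ (by simp)]; rfl
      rw [e] at ht
      have hv : 0 ≤ ArithmeticFunction.vonMangoldt n := ArithmeticFunction.vonMangoldt_nonneg
      have hfn : |f n| ≤ ArithmeticFunction.vonMangoldt n / n := by
        simp only [hf, ArithmeticFunction.coe_mk]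
        rw [abs_div, abs_mul, abs_of_nonneg hv, abs_of_pos hn0]
        gcongr
        exact mul_le_of_le_one_left hv (hx1 n)
      have hlt : (N : ℝ) ≤ n * ((N / n + 1 : ℕ) : ℝ) := by
        exact_mod_cast (Nat.lt_mul_div_succ N hn.1).le
      have hq : 2 * B / ((N / n + 1 : ℕ) : ℝ) ≤ 2 * B * n / N := by
        rw [div_le_div_iff₀ (by positivity) hNr]
        have := mul_le_mul_of_nonneg_left hlt (show 0 ≤ 2 * B by linarith)
        linarith
      rw [abs_mul]
      calc _ ≤ ArithmeticFunction.vonMangoldt n / n * (2 * B * n / N) :=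
            mul_le_mul hfn (ht.trans hq) (abs_nonneg _) (by positivity)
        _ = _ := by field_simp
    refine (Finset.abs_sum_le_sum_abs _ _).trans ((Finset.sum_le_sum hb).trans ?_)
    rw [← Finset.mul_sum]
    have hpsi := Chebyshev.psi_le_const_mul_self (x := N) hNr.le
    rw [Chebyshev.psi, Nat.floor_natCast] at hpsi
    calc _ ≤ 2 * B / N * ((Real.log 4 + 4) * N) := by gcongr
      _ = _ := by field_simp
  rw [le_div_iff₀ (abs_pos.mpr hL), mul_comm, ← abs_mul, hl]
  exact (abs_add_le _ _).trans (add_le_add hN1 hN2)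

lemma prime_log_bound (x : ℕ →*₀ ℝ) (hx1 : ∀ n, |x n| ≤ 1) (C : ℝ)
    (hC : ∀ N, |∑ n ∈ Finset.range N, x n * ArithmeticFunction.vonMangoldt n / n| ≤ C) :
    ∃ C', ∀ N, |∑ n ∈ Finset.range N, (if n.Prime then x n * Real.log n / n else 0)| ≤ C' := by
  have hs := ArithmeticFunction.vonMangoldt.summable_residueClass_non_primes_div (q := 1) 0
  have hs' : Summable fun n : ℕ => (if n.Prime then 0 else ArithmeticFunction.vonMangoldt n) / n := by
    refine hs.congr fun n => ?_
    congr 1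
    split_ifs
    · rfl
    · rw [ArithmeticFunction.vonMangoldt.residueClass, Set.indicator_of_mem]
      exact Subsingleton.elim _ _
  set T := ∑' n : ℕ, (if n.Prime then 0 else ArithmeticFunction.vonMangoldt n) / (n : ℝ) with hT
  refine ⟨C + T, fun N => ?_⟩
  have e : ∑ n ∈ Finset.range N, (if n.Prime then x n * Real.log n / n else 0) =
      ∑ n ∈ Finset.range N, x n * ArithmeticFunction.vonMangoldt n / n -
      ∑ n ∈ Finset.range N, x n * ((if n.Prime then 0 else ArithmeticFunction.vonMangoldt n) / n) := by
    rw [← Finset.sum_sub_distrib]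
    refine Finset.sum_congr rfl fun n _ => ?_
    split_ifs with hp
    · rw [ArithmeticFunction.vonMangoldt_apply_prime hp]; simp
    · ring
  rw [e]
  refine (abs_sub _ _).trans (add_le_add (hC N) ?_)
  refine (Finset.abs_sum_le_sum_abs _ _).trans ?_
  have h0 : ∀ n : ℕ, 0 ≤ (if n.Prime then 0 else ArithmeticFunction.vonMangoldt n) / (n : ℝ) := by
    intro n
    split_ifs
    · simp
    · exact div_nonneg ArithmeticFunction.vonMangoldt_nonneg (Nat.cast_nonneg _)
  refine le_trans (Finset.sum_le_sum fun n _ => ?_) (hs'.sum_le_tsum (Finset.range N) fun n _ => h0 n)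
  rw [abs_mul, abs_of_nonneg (h0 n)]
  exact mul_le_of_le_one_left (h0 n) (hx1 n)

/-- tails of the prime sum -/
lemma prime_tail (x : ℕ →*₀ ℝ) (C : ℝ)
    (hC : ∀ N, |∑ n ∈ Finset.range N, (if n.Prime then x n * Real.log n / n else 0)| ≤ C)
    (A : ℕ) (hA : 2 ≤ A) (M : ℕ) :
    |∑ n ∈ Finset.Ico A M, (if n.Prime then x n / n else 0)| ≤ 2 * C * (1 / Real.log A) := by
  have := abel_ineq _ (fun n => 1 / Real.log n) (2 * C) A (sum_Ico_bdd _ C hC A) ?_ ?_ M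
  · refine le_trans (le_of_eq ?_) this
    congr 1
    refine Finset.sum_congr rfl fun n hn => ?_
    rw [Finset.mem_Ico] at hn
    have : 0 < Real.log n := Real.log_pos (by exact_mod_cast (by omega : 1 < n))
    split_ifs
    · field_simp
    · simp
  · intro n hn
    have h1 : 0 < Real.log n := Real.log_pos (by exact_mod_cast (by omega : 1 < n))
    apply one_div_le_one_div_of_le h1
    apply Real.log_le_log (by exact_mod_cast (by omega : 0 < n)) (by push_cast; linarith)
  · intro n _
    exact div_nonneg zero_le_one (Real.log_natCast_nonneg n)

theorem curly_exists (x : ℕ →*₀ ℝ) (hx1 : ∀ n, |x n| ≤ 1) (B : ℝ)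
    (hB : ∀ N, |∑ n ∈ Finset.range N, x n| ≤ B) (Lr : ℝ → ℝ) (hL : Lr 1 ≠ 0)
    (hlim : ∀ s : ℝ, 1 ≤ s → Tendsto (fun N => ∑ n ∈ Finset.range N, x n * (n : ℝ) ^ (-s)) atTop (nhds (Lr s)))
    (hcont : ContinuousAt Lr 1) :
    ∃ l : ℝ, Tendsto (fun y : ℕ => ∑ p ∈ (Finset.range y).filter Nat.Prime, x p / (p : ℝ)) atTop (nhds l) ∧
      Real.exp l ≤ Lr 1 := by
  obtain ⟨C0, hC0⟩ := mertens_bound x hx1 B hB (Lr 1) hL (by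
    refine (hlim 1 le_rfl).congr fun N => Finset.sum_congr rfl fun n _ => ?_
    rw [Real.rpow_neg_one, div_eq_mul_inv])
  obtain ⟨C, hC⟩ := prime_log_bound x hx1 C0 hC0
  have hCn : 0 ≤ C := (abs_nonneg _).trans (hC 0)
  set u : ℕ → ℝ := fun n => if n.Prime then x n / n else 0 with hu
  have htail := prime_tail x C hC
  have hsmall : Tendsto (fun A : ℕ => 2 * C * (1 / Real.log A)) atTop (nhds 0) := by
    rw [← mul_zero (2 * C)]
    refine Tendsto.const_mul _ ?_
    simp only [one_div]
    exact tendsto_inv_atTop_zero.comp (Real.tendsto_log_atTop.comp tendsto_natCast_atTop_atTop)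
  have hsm : ∀ η > 0, ∃ A : ℕ, 2 ≤ A ∧ ∀ M, |∑ n ∈ Finset.Ico A M, u n| < η := by
    intro η hη
    obtain ⟨A, hA1, hA2⟩ := ((hsmall.eventually_lt_const hη).and (eventually_ge_atTop 2)).exists
    exact ⟨A, hA2, fun M => (htail A hA2 M).trans_lt hA1⟩
  have hcauchy : CauchySeq (fun N => ∑ n ∈ Finset.range N, u n) := by
    rw [Metric.cauchySeq_iff']
    intro η hη
    obtain ⟨A, _, hA⟩ := hsm η hη
    refine ⟨A, fun n hn => ?_⟩
    rw [Real.dist_eq, ← Finset.sum_Ico_eq_sub _ hn]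
    exact hA n
  obtain ⟨l, hl⟩ := cauchySeq_tendsto_of_complete hcauchy
  refine ⟨l, hl.congr fun N => (Finset.sum_filter _ _).symm, ?_⟩
  -- value
  have key : ∀ η > 0, Real.exp (l - 2 * η) ≤ Lr 1 := by
    intro η hη
    obtain ⟨A, hA2, hA⟩ := hsm η hη
    have h1 : l - η ≤ ∑ n ∈ Finset.range A, u n := by
      have : l ≤ ∑ n ∈ Finset.range A, u n + η := by
        refine le_of_tendsto hl ?_
        filter_upwards [eventually_ge_atTop A] with N hN
        rw [← Finset.sum_range_add_sum_Ico _ hN]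
        have := (le_abs_self _).trans (hA N).le
        linarith
      linarith
    have hs : ∀ s : ℝ, 1 < s → Real.exp (∑ n ∈ Finset.range A, u n * (n : ℝ) ^ (-(s - 1)) - η) ≤ Lr s := by
      intro s hs
      set f : ℕ →*₀ ℝ :=
        { toFun := fun n => x n * (n : ℝ) ^ (-s)
          map_zero' := by simp
          map_one' := by simp
          map_mul' := fun m n => by
            simp only [map_mul]; push_cast
            rw [Real.mul_rpow (Nat.cast_nonneg _) (Nat.cast_nonneg _)]; ring } with hf
      have hfa : ∀ n, f n = x n * (n : ℝ) ^ (-s) := fun n => rfl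
      have hfb : ∀ n, ‖f n‖ ≤ (n : ℝ) ^ (-s) := by
        intro n
        rw [hfa, norm_mul, Real.norm_eq_abs, Real.norm_eq_abs, abs_of_nonneg (by positivity : (0 : ℝ) ≤ (n : ℝ) ^ (-s))]
        exact mul_le_of_le_one_left (by positivity) (hx1 n)
      have hfs : Summable (fun n => ‖f n‖) :=
        Summable.of_nonneg_of_le (fun _ => norm_nonneg _) hfb (Real.summable_nat_rpow.mpr (by linarith))
      have hE := EulerProduct.eulerProduct_completely_multiplicative hfs
      have hval : ∑' n, f n = Lr s :=
        tendsto_nhds_unique hfs.of_norm.hasSum.tendsto_sum_nat (hlim s hs.le)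
      rw [hval] at hE
      refine ge_of_tendsto hE ?_
      filter_upwards [eventually_ge_atTop A] with N hN
      have hprod : Real.exp (∑ p ∈ Nat.primesBelow N, f p) ≤ ∏ p ∈ Nat.primesBelow N, (1 - f p)⁻¹ := by
        rw [Real.exp_sum]
        refine Finset.prod_le_prod (fun _ _ => (Real.exp_pos _).le) fun p hp => ?_
        have hp' := (Nat.prime_of_mem_primesBelow hp)
        have hlt : f p < 1 := by
          refine (le_abs_self _).trans_lt ((hfb p).trans_lt ?_)
          exact Real.rpow_lt_one_of_one_lt_of_neg (by exact_mod_cast hp'.one_lt) (by linarith)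
        rw [le_inv_comm₀ (Real.exp_pos _) (by linarith), ← Real.exp_neg]
        have := Real.add_one_le_exp (-f p)
        linarith
      refine le_trans (Real.exp_le_exp.mpr ?_) hprod
      have e : ∑ p ∈ Nat.primesBelow N, f p = ∑ n ∈ Finset.range N, u n * (n : ℝ) ^ (-(s - 1)) := by
        rw [Nat.primesBelow, Finset.sum_filter]
        refine Finset.sum_congr rfl fun n _ => ?_
        simp only [hu]
        split_ifs with hp
        · have : (0 : ℝ) < n := by exact_mod_cast hp.pos
          rw [hfa, show -s = -1 + -(s - 1) by ring, Real.rpow_add this, Real.rpow_neg_one]; ring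
        · simp
      rw [e, ← Finset.sum_range_add_sum_Ico _ hN]
      have := abel_ineq u (fun n => (n : ℝ) ^ (-(s - 1))) η A (fun M => (hA M).le) ?_ ?_ N
      · have h2 : (A : ℝ) ^ (-(s - 1)) ≤ 1 :=
          Real.rpow_le_one_of_one_le_of_nonpos (by exact_mod_cast (by omega : 1 ≤ A)) (by linarith)
        have h3 := neg_le_of_abs_le this
        have h4 : η * (A : ℝ) ^ (-(s - 1)) ≤ η := mul_le_of_le_one_right hη.le h2
        linarith
      · intro n hn
        exact Real.rpow_le_rpow_of_nonpos (by exact_mod_cast (by omega : 0 < n)) (by push_cast; linarith) (by linarith)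
      · intro n _; positivity
    have ht1 : Tendsto Lr (nhdsWithin 1 (Set.Ioi 1)) (nhds (Lr 1)) := hcont.tendsto.mono_left nhdsWithin_le_nhds
    have ht2 : Tendsto (fun s : ℝ => Real.exp (∑ n ∈ Finset.range A, u n * (n : ℝ) ^ (-(s - 1)) - η))
        (nhdsWithin 1 (Set.Ioi 1)) (nhds (Real.exp (∑ n ∈ Finset.range A, u n - η))) := by
      refine Tendsto.mono_left ?_ nhdsWithin_le_nhds
      refine (Real.continuous_exp.tendsto _).comp (Tendsto.sub_const ?_ _)
      refine tendsto_finsetSum _ fun n _ => ?_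
      rcases Nat.eq_zero_or_pos n with h0 | h0
      · subst h0; simp [hu]
      have hc : ContinuousAt (fun s : ℝ => u n * (n : ℝ) ^ (-(s - 1))) 1 := by
        refine ContinuousAt.mul continuousAt_const ?_
        refine ContinuousAt.rpow continuousAt_const (by fun_prop) (Or.inl ?_)
        exact_mod_cast h0.ne'
      have := hc.tendsto
      simpa using this
    have := le_of_tendsto_of_tendsto ht2 ht1 (by
      filter_upwards [self_mem_nhdsWithin] with s hs1
      exact hs s hs1)
    exact le_trans (Real.exp_le_exp.mpr (by linarith)) this
  have hk : Tendsto (fun η : ℝ => Real.exp (l - 2 * η)) (nhdsWithin 0 (Set.Ioi 0)) (nhds (Real.exp l)) := by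
    refine Tendsto.mono_left ?_ nhdsWithin_le_nhds
    have : Continuous fun η : ℝ => Real.exp (l - 2 * η) := by fun_prop
    simpa using this.tendsto 0
  refine le_of_tendsto hk ?_
  filter_upwards [self_mem_nhdsWithin] with η hη
  exact key η hη


/-- the Jacobi symbol restricted to integers coprime to `W` -/
noncomputable def Y (d W n : ℕ) : ℝ := if Nat.Coprime n W then J n d else 0

lemma Y_abs_le (d W n : ℕ) : |Y d W n| ≤ 1 := by
  unfold Y; split_ifs
  · exact J_abs_le _ _
  · simp

lemma Y_zero (d W : ℕ) (hd : 1 < d) : Y d W 0 = 0 := by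
  unfold Y; split_ifs
  · exact J_eq_zero (by omega) (by simp; omega)
  · rfl

lemma Y_one (d W : ℕ) : Y d W 1 = 1 := by
  simp [Y, J]

lemma Y_of_one (d n : ℕ) : Y d 1 n = J n d := by simp [Y]

lemma jchar_J (d : ℕ) [NeZero d] (n : ℕ) : jchar d (n : ZMod d) = ((J n d : ℝ) : ℂ) := by
  rw [jchar_natCast]; simp [J]

lemma changeLevel_Y (d W n : ℕ) [NeZero d] [NeZero (d * W)] :
    (DirichletCharacter.changeLevel (Dvd.intro W rfl : d ∣ d * W) (jchar d)) (n : ZMod (d * W)) =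
      ((Y d W n : ℝ) : ℂ) := by
  by_cases h : Nat.Coprime n (d * W)
  · have := DirichletCharacter.changeLevel_eq_cast_of_dvd' (jchar d) (Dvd.intro W rfl : d ∣ d * W) (a := (n : ℤ))
      (by exact_mod_cast Nat.isCoprime_iff_coprime.mpr h)
    push_cast at this
    rw [this, jchar_J, Y, if_pos (Nat.Coprime.coprime_mul_left_right h)]
  · rw [MulChar.map_nonunit]
    · have : Y d W n = 0 := by
        unfold Y
        split_ifs with hW
        · apply J_eq_zero (NeZero.ne d)
          intro hd
          exact h (Nat.Coprime.mul_right hd hW)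
        · rfl
      rw [this]; simp
    · rwa [ZMod.isUnit_iff_coprime]

lemma ofReal_natCast_cpow (n : ℕ) (s : ℝ) : ((n : ℕ) : ℂ) ^ (-(s : ℂ)) = (((n : ℝ) ^ (-s) : ℝ) : ℂ) := by
  rw [Complex.ofReal_cpow (Nat.cast_nonneg _)]
  push_cast; rfl

lemma Y_tendsto (d W : ℕ) [NeZero d] (hW : W ≠ 0) (h1 : 1 < d) (hodd : Odd d) (hs : Squarefree d)
    (s : ℝ) (hs0 : 0 < s) :
    Tendsto (fun N => ((∑ n ∈ Finset.range N, Y d W n * (n : ℝ) ^ (-s) : ℝ) : ℂ)) atTop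
      (nhds (DirichletCharacter.LFunction (jchar d) s *
        ((∏ p ∈ (d * W).primeFactors, (1 - J p d * (p : ℝ) ^ (-s)) : ℝ) : ℂ))) := by
  haveI : NeZero (d * W) := ⟨mul_ne_zero (NeZero.ne d) hW⟩
  have hne := jchar_ne_one d hodd hs h1
  have hne' : DirichletCharacter.changeLevel (Dvd.intro W rfl : d ∣ d * W) (jchar d) ≠ 1 := by
    rw [Ne, DirichletCharacter.changeLevel_eq_one_iff]; exact hne
  have h := PS_tendsto (d * W) _ hne' (s : ℂ) (by simpa using hs0)
  rw [DirichletCharacter.LFunction_changeLevel _ _ (Or.inl hne)] at h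
  rw [← tendsto_add_atTop_iff_nat 1]
  have e : ∏ p ∈ (d * W).primeFactors, (1 - jchar d (p : ZMod d) * (p : ℂ) ^ (-(s : ℂ))) =
      ((∏ p ∈ (d * W).primeFactors, (1 - J p d * (p : ℝ) ^ (-s)) : ℝ) : ℂ) := by
    rw [Complex.ofReal_prod]
    refine Finset.prod_congr rfl fun p _ => ?_
    rw [jchar_J, ofReal_natCast_cpow]; push_cast; rfl
  rw [e] at h
  refine h.congr fun N => ?_
  rw [Finset.sum_range_succ', Y_zero d W h1, zero_mul, add_zero, PS, Complex.ofReal_sum]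
  refine Finset.sum_congr rfl fun n _ => ?_
  rw [changeLevel_Y, ofReal_natCast_cpow]; push_cast; rfl

/-- the value of the L-function at a real point, as a real number -/
noncomputable def Lr (d : ℕ) [NeZero d] (s : ℝ) : ℝ := (DirichletCharacter.LFunction (jchar d) s).re

lemma LFunction_eq_Lr (d : ℕ) [NeZero d] (h1 : 1 < d) (hodd : Odd d) (hs : Squarefree d)
    (s : ℝ) (hs0 : 0 < s) : DirichletCharacter.LFunction (jchar d) s = (Lr d s : ℂ) := by
  have hne := jchar_ne_one d hodd hs h1
  have h := PS_tendsto d _ hne (s : ℂ) (by simpa using hs0)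
  have him := (Complex.continuous_im.tendsto _).comp h
  have h0 : (DirichletCharacter.LFunction (jchar d) s).im = 0 := by
    refine tendsto_nhds_unique him (tendsto_const_nhds.congr fun N => ?_)
    simp only [Function.comp, PS]
    rw [Complex.im_sum]
    symm
    refine Finset.sum_eq_zero fun n _ => ?_
    rw [jchar_J, ofReal_natCast_cpow, ← Complex.ofReal_mul, Complex.ofReal_im]
  apply Complex.ext
  · simp [Lr]
  · simp [h0]

lemma Y_tendsto_real (d W : ℕ) [NeZero d] (hW : W ≠ 0) (h1 : 1 < d) (hodd : Odd d) (hs : Squarefree d)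
    (s : ℝ) (hs0 : 0 < s) :
    Tendsto (fun N => ∑ n ∈ Finset.range N, Y d W n * (n : ℝ) ^ (-s)) atTop
      (nhds (Lr d s * ∏ p ∈ (d * W).primeFactors, (1 - J p d * (p : ℝ) ^ (-s)))) := by
  have h := Y_tendsto d W hW h1 hodd hs s hs0
  rw [LFunction_eq_Lr d h1 hodd hs s hs0, ← Complex.ofReal_mul] at h
  have := (Complex.continuous_re.tendsto _).comp h
  simpa only [Function.comp_def, Complex.ofReal_re] using this

/-- The Jacobi symbol as a monoid hom with zero. -/
noncomputable def Jhom (d : ℕ) (hd : 1 < d) : ℕ →*₀ ℝ where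
  toFun n := J n d
  map_zero' := by have := Y_zero d 1 hd; rwa [Y_of_one] at this
  map_one' := by have := Y_one d 1; rwa [Y_of_one] at this
  map_mul' m n := J_mul_left m n d

lemma curly_d (d : ℕ) [NeZero d] (h1 : 1 < d) (hodd : Odd d) (hs : Squarefree d) :
    ∃ l : ℝ, HasCurlyL (jchar d) l ∧ Real.exp l ≤ Lr d 1 := by
  have hne := jchar_ne_one d hodd hs h1
  have key := curly_exists (Jhom d h1) (fun n => J_abs_le n d) (Real.sqrt d * (1 + Real.log d))
    (fun N => by
      have := J_PV_Ico d h1 hodd hs 0 N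
      rw [← Finset.range_eq_Ico] at this
      exact this) (Lr d) ?_ ?_ ?_
  · obtain ⟨l, hl, hle⟩ := key
    refine ⟨l, ?_, hle⟩
    unfold HasCurlyL
    refine hl.congr fun y => Finset.sum_congr rfl fun p _ => ?_
    rw [jchar_J, Complex.ofReal_re]; rfl
  · have h := DirichletCharacter.LFunction_apply_one_ne_zero hne
    intro h0
    have := LFunction_eq_Lr d h1 hodd hs 1 one_pos
    rw [h0] at this
    exact h (by simpa using this)
  · intro s hs1
    have h := Y_tendsto_real d 1 one_ne_zero h1 hodd hs s (by linarith)
    have e : ∏ p ∈ (d * 1).primeFactors, (1 - J p d * (p : ℝ) ^ (-s)) = 1 := by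
      refine Finset.prod_eq_one fun p hp => ?_
      rw [mul_one] at hp
      rw [J_eq_zero (by omega)]
      · simp
      · intro hc
        have := Nat.dvd_gcd (dvd_refl p) (Nat.dvd_of_mem_primeFactors hp)
        rw [hc] at this
        exact (Nat.prime_of_mem_primeFactors hp).one_lt.ne' (Nat.dvd_one.mp this)
    rw [e, mul_one] at h
    refine h.congr fun N => Finset.sum_congr rfl fun n _ => ?_
    rw [Y_of_one]; rfl
  · have : Continuous (Lr d) := Complex.continuous_re.comp
      ((DirichletCharacter.differentiable_LFunction hne).continuous.comp Complex.continuous_ofReal)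
    exact this.continuousAt

lemma L_control (d W : ℕ) [NeZero d] (hW : W ≠ 0) (h1 : 1 < d) (hodd : Odd d) (hs : Squarefree d)
    (s : ℝ) (hs0 : 0 < s) (N0 : ℕ) (h : ∀ N, N0 ≤ N → |∑ n ∈ Finset.Ico 2 N, Y d W n * (n : ℝ) ^ (-s)| ≤ 3 / 4) :
    DirichletCharacter.LFunction (jchar d) s ≠ 0 ∧
    Lr d s * ∏ p ∈ (d * W).primeFactors, (1 - J p d * (p : ℝ) ^ (-s)) ≤ 2 := by
  have ht := Y_tendsto_real d W hW h1 hodd hs s hs0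
  have h2 : ∀ N, 2 ≤ N → ∑ n ∈ Finset.range N, Y d W n * (n : ℝ) ^ (-s) =
      1 + ∑ n ∈ Finset.Ico 2 N, Y d W n * (n : ℝ) ^ (-s) := by
    intro N hN
    rw [← Finset.sum_range_add_sum_Ico _ hN]
    simp [Finset.sum_range_succ, Y_zero d W h1, Y_one]
  have lo : 1 / 4 ≤ Lr d s * ∏ p ∈ (d * W).primeFactors, (1 - J p d * (p : ℝ) ^ (-s)) := by
    refine ge_of_tendsto ht ?_
    filter_upwards [eventually_ge_atTop 2, eventually_ge_atTop N0] with N hN hN0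
    rw [h2 N hN]
    have := neg_le_of_abs_le (h N hN0)
    linarith
  constructor
  · rw [LFunction_eq_Lr d h1 hodd hs s hs0]
    intro h0
    have : Lr d s = 0 := by exact_mod_cast h0
    rw [this] at lo
    norm_num at lo
  · refine le_of_tendsto ht ?_
    filter_upwards [eventually_ge_atTop 2, eventually_ge_atTop N0] with N hN hN0
    rw [h2 N hN]
    have := le_of_abs_le (h N hN0)
    linarith


lemma prod_one_sub_sq (z : ℕ) : (1 : ℝ) / 2 ≤ ∏ n ∈ Finset.Icc 2 z, (1 - 1 / (n : ℝ) ^ 2) := by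
  rcases Nat.lt_or_ge z 2 with h | h
  · rw [Finset.Icc_eq_empty (by omega)]; norm_num
  have key : (∏ n ∈ Finset.Icc 2 z, (1 - 1 / (n : ℝ) ^ 2) : ℝ) = ((z : ℝ) + 1) / (2 * (z : ℝ)) := by
    induction z, h using Nat.le_induction with
    | base => norm_num
    | succ n hn ih =>
      rw [Finset.prod_Icc_succ_top (by omega), ih]
      have : (0 : ℝ) < n := by exact_mod_cast (by omega : 0 < n)
      push_cast
      field_simp
      ring
  rw [key]
  have : (0 : ℝ) < z := by exact_mod_cast (by omega : 0 < z)
  rw [div_le_div_iff₀ (by norm_num) (by positivity)]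
  linarith

lemma mertens_prod (z : ℕ) : Real.log z / 2 ≤ ∏ p ∈ (z + 1).primesBelow, (1 + 1 / (p : ℝ)) := by
  set f : ℕ →* ℝ :=
    { toFun := fun n => ((n : ℝ))⁻¹
      map_one' := by simp
      map_mul' := fun m n => by push_cast; rw [mul_inv] } with hf
  have hfa : ∀ n, f n = ((n : ℝ))⁻¹ := fun _ => rfl
  have hE := (EulerProduct.summable_and_hasSum_smoothNumbers_prod_primesBelow_geometric (f := f) (by
    intro p hp
    rw [hfa, Real.norm_eq_abs, abs_of_nonneg (by positivity)]
    exact inv_lt_one_of_one_lt₀ (by exact_mod_cast hp.one_lt)) (z + 1)).2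
  have hE' := (hasSum_subtype_iff_indicator (f := fun n => f n) (s := ((z + 1).smoothNumbers : Set ℕ))).mp hE
  have h1 : Real.log z ≤ ∏ p ∈ (z + 1).primesBelow, (1 - f p)⁻¹ := by
    have hle := sum_le_hasSum (Finset.Icc 1 z) (fun n _ => by
      apply Set.indicator_nonneg; intro m _; rw [hfa]; positivity) hE'
    refine le_trans ?_ hle
    have hh := log_add_one_le_harmonic z
    have hz : Real.log z ≤ Real.log ((z + 1 : ℕ) : ℝ) := by
      rcases Nat.eq_zero_or_pos z with h | h
      · subst h; simp
      · exact Real.log_le_log (by exact_mod_cast h) (by push_cast; linarith)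
    push_cast at hz
    refine hz.trans ?_
    push_cast at hh
    refine hh.trans ?_
    rw [harmonic_eq_sum_Icc]; push_cast
    refine Finset.sum_le_sum fun n hn => ?_
    rw [Finset.mem_Icc] at hn
    rw [Set.indicator_of_mem]
    · rw [hfa]
    · apply Nat.mem_smoothNumbers'.mpr
      intro p hp hpn
      have := Nat.le_of_dvd (by omega) hpn
      omega
  have h2 : ∏ p ∈ (z + 1).primesBelow, (1 + 1 / (p : ℝ)) =
      (∏ p ∈ (z + 1).primesBelow, (1 - 1 / (p : ℝ) ^ 2)) * ∏ p ∈ (z + 1).primesBelow, (1 - f p)⁻¹ := by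
    rw [← Finset.prod_mul_distrib]
    refine Finset.prod_congr rfl fun p hp => ?_
    have hp' := (Nat.prime_of_mem_primesBelow hp).one_lt
    have h1 : (1 : ℝ) < p := by exact_mod_cast hp'
    rw [hfa]
    have h3 : (p : ℝ) - 1 ≠ 0 := by linarith
    have h4 : (1 : ℝ) - (p : ℝ)⁻¹ ≠ 0 := by
      have : (p : ℝ)⁻¹ < 1 := inv_lt_one_of_one_lt₀ h1
      linarith
    field_simp
    ring
  have h3 : (1 : ℝ) / 2 ≤ ∏ p ∈ (z + 1).primesBelow, (1 - 1 / (p : ℝ) ^ 2) := by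
    refine (prod_one_sub_sq z).trans ?_
    have hn : ∀ n : ℕ, 2 ≤ n → 0 ≤ 1 - 1 / (n : ℝ) ^ 2 ∧ 1 - 1 / (n : ℝ) ^ 2 ≤ 1 := by
      intro n hn
      have h2 : (2 : ℝ) ≤ n := by exact_mod_cast hn
      have : 1 / (n : ℝ) ^ 2 ≤ 1 := by
        rw [div_le_one (by positivity)]; nlinarith
      have : 0 ≤ 1 / (n : ℝ) ^ 2 := by positivity
      constructor <;> linarith
    apply Finset.prod_le_prod_of_subset_of_le_one
    · intro p hp
      have h1 := (Nat.prime_of_mem_primesBelow hp).two_le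
      have h2 := Nat.lt_of_mem_primesBelow hp
      rw [Finset.mem_Icc]; omega
    · intro i hi
      exact (hn i (Finset.mem_Icc.mp hi).1).1
    · intro i hi _
      exact (hn i (Finset.mem_Icc.mp hi).1).2
  have h0 : 0 ≤ Real.log z := Real.log_natCast_nonneg z
  rw [h2]
  calc Real.log z / 2 = 1 / 2 * Real.log z := by ring
    _ ≤ _ := mul_le_mul h3 h1 h0 (by linarith)

/-- the modulus -/
def WW (z : ℕ) : ℕ := primorial z ^ 3

lemma WW_pos (z : ℕ) : 0 < WW z := pow_pos (primorial_pos z) 3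

lemma WW_le (z : ℕ) : WW z ≤ 64 ^ z := by
  unfold WW
  calc primorial z ^ 3 ≤ (4 ^ z) ^ 3 := Nat.pow_le_pow_left (primorial_le_four_pow z) 3
    _ = 64 ^ z := by rw [← pow_mul, mul_comm, pow_mul]; norm_num

lemma prime_dvd_WW {p z : ℕ} (hp : p.Prime) : p ∣ WW z ↔ p ≤ z := by
  unfold WW
  rw [hp.prime.dvd_pow_iff_dvd three_ne_zero]
  unfold primorial
  rw [Prime.dvd_finset_prod_iff hp.prime]
  constructor
  · rintro ⟨q, hq, hpq⟩
    rw [Finset.mem_filter, Finset.mem_range] at hq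
    have := (Nat.prime_dvd_prime_iff_eq hp hq.2).mp hpq
    omega
  · intro h
    exact ⟨p, by rw [Finset.mem_filter, Finset.mem_range]; exact ⟨by omega, hp⟩, dvd_rfl⟩

lemma exists_a (z : ℕ) (hz : 2 ≤ z) : ∃ a < WW z, ∀ k, (a + WW z * k) % 8 = 5 ∧
    ∀ p, p.Prime → p ≤ z → J p (a + WW z * k) = -1 := by
  have hnr : ∀ p : ℕ, p.Prime → p ≠ 2 → ∃ r : ℕ, ¬ IsSquare (r : ZMod p) := by
    intro p hp h2
    haveI := Fact.mk hp
    obtain ⟨r, hr⟩ := FiniteField.exists_nonsquare (F := ZMod p) (by rwa [ZMod.ringChar_zmod_n])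
    exact ⟨r.val, by rwa [ZMod.natCast_zmod_val]⟩
  choose! r hr using hnr
  set t := (Finset.range (z + 1)).filter Nat.Prime with ht
  have hcop : Set.Pairwise (t : Set ℕ) (Function.onFun Nat.Coprime (fun p => p ^ 3)) := by
    intro p hp q hq hpq
    simp only [ht, Finset.coe_filter, Set.mem_setOf_eq] at hp hq
    exact Nat.Coprime.pow 3 3 ((Nat.coprime_primes hp.2 hq.2).mpr hpq)
  obtain ⟨k0, hk0⟩ := Nat.chineseRemainderOfFinset (fun p => if p = 2 then 5 else r p) (fun p => p ^ 3) t
    (fun p hp => by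
      rw [ht, Finset.mem_filter] at hp
      exact pow_ne_zero 3 hp.2.ne_zero) hcop
  refine ⟨k0 % WW z, Nat.mod_lt _ (WW_pos z), fun k => ?_⟩
  have hdvd : ∀ p, p.Prime → p ≤ z → p ^ 3 ∣ WW z := by
    intro p hp hpz
    unfold WW
    apply pow_dvd_pow_of_dvd
    have := (prime_dvd_WW (z := z) hp).mpr hpz
    exact (hp.prime.dvd_pow_iff_dvd three_ne_zero).mp this
  have hmod : ∀ p, p.Prime → p ≤ z → k0 % WW z + WW z * k ≡ (if p = 2 then 5 else r p) [MOD p ^ 3] := by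
    intro p hp hpz
    have h1 := hk0 p (by rw [ht, Finset.mem_filter, Finset.mem_range]; exact ⟨by omega, hp⟩)
    have h2 : k0 % WW z + WW z * k ≡ k0 [MOD WW z] := by
      simp [Nat.ModEq, Nat.add_mod]
    exact (h2.of_dvd (hdvd p hp hpz)).trans h1
  set d := k0 % WW z + WW z * k with hd
  have h8 : d % 8 = 5 := by
    have := hmod 2 Nat.prime_two hz
    simpa [Nat.ModEq] using this
  refine ⟨h8, fun p hp hpz => ?_⟩
  have hodd : Odd d := by rw [Nat.odd_iff]; omega
  unfold J
  rcases eq_or_ne p 2 with h2 | h2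
  · subst h2
    have := jacobiSym.at_two hodd
    push_cast
    rw [this, ZMod.χ₈_nat_eq_if_mod_eight, if_neg (by omega), if_neg (by omega)]
    norm_num
  · have hpo : Odd p := hp.odd_of_ne_two h2
    haveI := Fact.mk hp
    rw [← jacobiSym.quadratic_reciprocity_one_mod_four (by omega : d % 4 = 1) hpo,
      ← jacobiSym.legendreSym.to_jacobiSym]
    have : legendreSym p d = -1 := by
      rw [legendreSym.eq_neg_one_iff]
      have h3 := hmod p hp hpz
      rw [if_neg h2] at h3
      have h4 : (d : ZMod p) = (r p : ZMod p) :=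
        (ZMod.natCast_eq_natCast_iff _ _ _).mpr (h3.of_dvd (dvd_pow_self p three_ne_zero))
      push_cast
      rw [h4]
      exact hr p hp h2
    rw [this]; norm_num

lemma count_dvd (a W K g : ℕ) (hg : 0 < g) (hc : Nat.Coprime W g) :
    ((Finset.range K).filter (fun k => g ∣ a + W * k)).card ≤ K / g + 1 := by
  rw [← Finset.card_range (K / g + 1)]
  apply Finset.card_le_card_of_injOn (fun k => k / g)
  · intro k hk
    simp only [Finset.coe_filter, Finset.mem_range, Set.mem_setOf_eq] at hk
    simp only [Finset.coe_range, Set.mem_Iio]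
    exact Nat.lt_succ_of_le (Nat.div_le_div_right hk.1.le)
  · intro k hk l hl hkl
    simp only [Finset.coe_filter, Finset.mem_range, Set.mem_setOf_eq] at hk hl
    have h1 : a + W * k ≡ a + W * l [MOD g] :=
      ((Nat.modEq_zero_iff_dvd.mpr hk.2)).trans (Nat.modEq_zero_iff_dvd.mpr hl.2).symm
    have h2 : W * k ≡ W * l [MOD g] := Nat.ModEq.add_left_cancel' a h1
    have h3 : k ≡ l [MOD g] := Nat.ModEq.cancel_left_of_coprime (by rw [Nat.gcd_comm]; exact hc) h2
    rw [← Nat.div_add_mod k g, ← Nat.div_add_mod l g]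
    dsimp only at hkl
    rw [hkl, h3]

lemma count_nonsqfree (z a K R : ℕ) (hz : 2 ≤ z) (haz : a < WW z)
    (ha : ∀ k, ∀ p, p.Prime → p ≤ z → J p (a + WW z * k) = -1)
    (hodd : ∀ k, Odd (a + WW z * k)) (hR : WW z * K ≤ R ^ 2) :
    (((Finset.range K).filter (fun k => ¬ Squarefree (a + WW z * k))).card : ℝ) ≤ K / z + R := by
  classical
  have hsub : (Finset.range K).filter (fun k => ¬ Squarefree (a + WW z * k)) ⊆
      ((Finset.Ioc z R).filter Nat.Prime).biUnion
        (fun p => (Finset.range K).filter (fun k => p ^ 2 ∣ a + WW z * k)) := by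
    intro k hk
    rw [Finset.mem_filter, Finset.mem_range] at hk
    rw [Nat.squarefree_iff_prime_squarefree] at hk
    push Not at hk
    obtain ⟨hkK, p, hp, hpd⟩ := hk
    have hd0 : a + WW z * k ≠ 0 := by
      intro h; have := hodd k; rw [h] at this; simp at this
    rw [Finset.mem_biUnion]
    refine ⟨p, ?_, ?_⟩
    · rw [Finset.mem_filter, Finset.mem_Ioc]
      refine ⟨⟨?_, ?_⟩, hp⟩
      · by_contra hle
        have h1 := ha k p hp (by omega)
        rw [J_eq_zero hd0] at h1
        · norm_num at h1
        · intro hc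
          have := Nat.dvd_gcd (dvd_refl p) ((dvd_mul_right p p).trans hpd)
          rw [hc] at this
          exact hp.one_lt.ne' (Nat.dvd_one.mp this)
      · have h1 := Nat.le_of_dvd (Nat.pos_of_ne_zero hd0) hpd
        have h2 : a + WW z * k ≤ WW z * K := by
          have : WW z * (k + 1) ≤ WW z * K := Nat.mul_le_mul_left _ hkK
          rw [mul_add] at this; omega
        nlinarith
    · rw [Finset.mem_filter, Finset.mem_range, pow_two]
      exact ⟨hkK, hpd⟩
  have h1 := (Finset.card_le_card hsub).trans Finset.card_biUnion_le
  have h2 : ∑ p ∈ (Finset.Ioc z R).filter Nat.Prime,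
      ((Finset.range K).filter (fun k => p ^ 2 ∣ a + WW z * k)).card ≤
      ∑ p ∈ Finset.Ioc z R, (K / p ^ 2 + 1) := by
    refine (Finset.sum_le_sum fun p hp => ?_).trans
      (Finset.sum_le_sum_of_subset (Finset.filter_subset _ _))
    rw [Finset.mem_filter, Finset.mem_Ioc] at hp
    apply count_dvd _ _ _ _ (pow_pos hp.2.pos 2)
    apply Nat.Coprime.pow_right
    rw [Nat.coprime_comm, Nat.Prime.coprime_iff_not_dvd hp.2, prime_dvd_WW hp.2]
    omega
  have h3 : ((∑ p ∈ Finset.Ioc z R, (K / p ^ 2 + 1) : ℕ) : ℝ) ≤ K / z + R := by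
    push_cast
    rw [Finset.sum_add_distrib]
    apply add_le_add
    · calc ∑ p ∈ Finset.Ioc z R, ((K / p ^ 2 : ℕ) : ℝ) ≤ ∑ p ∈ Finset.Ioc z R, (K : ℝ) * (1 / (p : ℝ) ^ 2) := by
            refine Finset.sum_le_sum fun p _ => ?_
            refine Nat.cast_div_le.trans (le_of_eq ?_)
            push_cast; ring
        _ = (K : ℝ) * ∑ p ∈ Finset.Ioc z R, 1 / (p : ℝ) ^ 2 := by rw [Finset.mul_sum]
        _ ≤ K * (1 / z) := mul_le_mul_of_nonneg_left (sum_inv_sq_tail z R (by omega)) (Nat.cast_nonneg _)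
        _ = _ := by ring
    · simp
  exact le_trans (by exact_mod_cast h1.trans h2) h3


lemma abel_identity (x S w : ℕ → ℝ) (hS : ∀ t, S t = ∑ n ∈ Finset.Ico 2 (t + 1), x n) (N : ℕ) (hN : 1 ≤ N) :
    ∑ n ∈ Finset.Ico 2 (N + 1), x n * w n = S N * w N - ∑ n ∈ Finset.Ico 1 N, S n * (w (n + 1) - w n) := by
  induction N, hN using Nat.le_induction with
  | base => simp [hS]
  | succ n hn ih =>
    rw [Finset.sum_Ico_succ_top (by omega), ih, Finset.sum_Ico_succ_top (by omega)]
    have : S (n + 1) = S n + x (n + 1) := by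
      rw [hS, hS, Finset.sum_Ico_succ_top (by omega)]
    rw [this]; ring

lemma rpow_step (δ : ℝ) (h0 : 0 ≤ δ) (h1 : δ ≤ 1) (n : ℕ) (hn : 1 ≤ n) :
    0 ≤ ((n + 1 : ℕ) : ℝ) ^ δ - (n : ℝ) ^ δ ∧
    ((n + 1 : ℕ) : ℝ) ^ δ - (n : ℝ) ^ δ ≤ (n : ℝ) ^ δ * (δ * (1 / n)) := by
  have hp : (0 : ℝ) < n := by exact_mod_cast hn
  constructor
  · have : (n : ℝ) ^ δ ≤ ((n + 1 : ℕ) : ℝ) ^ δ :=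
      Real.rpow_le_rpow hp.le (by push_cast; linarith) h0
    linarith
  · have e : ((n + 1 : ℕ) : ℝ) = n * (1 + 1 / n) := by push_cast; field_simp
    have hb := rpow_one_add_le_one_add_mul_self (s := 1 / (n : ℝ)) (by
      have : (0 : ℝ) ≤ 1 / n := by positivity
      linarith) h0 h1
    rw [e, Real.mul_rpow hp.le (by positivity)]
    have := mul_le_mul_of_nonneg_left hb (Real.rpow_nonneg hp.le δ)
    linarith

lemma rpow_le_three (N : ℕ) (hN : 1 ≤ N) (Λ δ : ℝ) (hΛ : 1 ≤ Λ) (hNL : Real.log N ≤ Λ)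
    (hd0 : 0 ≤ δ) (hd : δ ≤ 1 / Λ) : (N : ℝ) ^ δ ≤ 3 := by
  have hp : (0 : ℝ) < N := by exact_mod_cast hN
  have hl := Real.log_natCast_nonneg N
  rw [Real.rpow_def_of_pos hp]
  have : Real.log N * δ ≤ 1 := by
    calc Real.log N * δ ≤ Λ * (1 / Λ) := mul_le_mul hNL hd hd0 (by linarith)
      _ = 1 := by field_simp
  calc Real.exp (Real.log N * δ) ≤ Real.exp 1 := Real.exp_le_exp.mpr this
    _ ≤ 3 := by linarith [Real.exp_one_lt_d9]

lemma abel_small (x S : ℕ → ℝ) (hS : ∀ t, S t = ∑ n ∈ Finset.Ico 2 (t + 1), x n)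
    (N : ℕ) (hN : 1 ≤ N) (Λ δ : ℝ) (hΛ : 1 ≤ Λ) (hNL : Real.log N ≤ Λ)
    (hd0 : 0 ≤ δ) (hd : δ ≤ 1 / Λ)
    (hU : S N ^ 2 + 1 / Λ * ∑ n ∈ Finset.Ico 1 N, S n ^ 2 / n ≤ 1 / 200) :
    |∑ n ∈ Finset.Ico 2 (N + 1), x n * (n : ℝ) ^ δ| ≤ 1 / 2 := by
  rw [abel_identity x S (fun n => (n : ℝ) ^ δ) hS N hN]
  have hd1 : δ ≤ 1 := hd.trans (by rw [div_le_one (by linarith)]; exact hΛ)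
  have hΛ0 : 0 ≤ 1 / Λ := by positivity
  have habs : ∀ s : ℝ, |s| ≤ 1 / 60 + 15 * s ^ 2 := by
    intro s
    rw [← sq_abs]
    nlinarith [sq_nonneg (30 * |s| - 1)]
  have h3 := rpow_le_three N hN Λ δ hΛ hNL hd0 hd
  have hterm : ∀ n ∈ Finset.Ico 1 N, |S n * (((n + 1 : ℕ) : ℝ) ^ δ - (n : ℝ) ^ δ)| ≤
      3 * (1 / Λ) * ((1 / 60) * (1 / n) + 15 * (S n ^ 2 / n)) := by
    intro n hn
    rw [Finset.mem_Ico] at hn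
    have hp : (0 : ℝ) < n := by exact_mod_cast hn.1
    obtain ⟨a1, a2⟩ := rpow_step δ hd0 hd1 n hn.1
    have b1 : (n : ℝ) ^ δ ≤ 3 := (Real.rpow_le_rpow hp.le (by exact_mod_cast hn.2.le) hd0).trans h3
    rw [abs_mul, abs_of_nonneg a1]
    have b2 : ((n + 1 : ℕ) : ℝ) ^ δ - (n : ℝ) ^ δ ≤ 3 * (1 / Λ * (1 / n)) := by
      refine a2.trans (mul_le_mul b1 ?_ (by positivity) (by norm_num))
      exact mul_le_mul_of_nonneg_right hd (by positivity)
    calc |S n| * (((n + 1 : ℕ) : ℝ) ^ δ - (n : ℝ) ^ δ) ≤ (1 / 60 + 15 * S n ^ 2) * (3 * (1 / Λ * (1 / n))) :=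
          mul_le_mul (habs _) b2 a1 (by positivity)
      _ = _ := by ring
  have hsum := (Finset.abs_sum_le_sum_abs (fun n : ℕ => S n * (((n + 1 : ℕ) : ℝ) ^ δ - (n : ℝ) ^ δ)) (Finset.Ico 1 N)).trans
    (Finset.sum_le_sum hterm)
  rw [← Finset.mul_sum, Finset.sum_add_distrib, ← Finset.mul_sum, ← Finset.mul_sum] at hsum
  have hh := sum_inv_le_log N
  have hh2 : 1 / Λ * ∑ n ∈ Finset.Ico 1 N, (1 : ℝ) / n ≤ 2 := by
    calc 1 / Λ * ∑ n ∈ Finset.Ico 1 N, (1 : ℝ) / n ≤ 1 / Λ * (2 * Λ) :=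
          mul_le_mul_of_nonneg_left (by linarith) hΛ0
      _ = 2 := by field_simp
  have hw0 : (0 : ℝ) ≤ (N : ℝ) ^ δ := by positivity
  have hfirst : |S N * (N : ℝ) ^ δ| ≤ 3 * (1 / 60 + 15 * S N ^ 2) := by
    rw [abs_mul, abs_of_nonneg hw0, mul_comm]
    exact mul_le_mul h3 (habs _) (abs_nonneg _) (by norm_num)
  have htri := abs_sub (S N * (N : ℝ) ^ δ) (∑ n ∈ Finset.Ico 1 N, S n * (((n + 1 : ℕ) : ℝ) ^ δ - (n : ℝ) ^ δ))
  set P := 1 / Λ * ∑ n ∈ Finset.Ico 1 N, (1 : ℝ) / n with hP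
  set Q := 1 / Λ * ∑ n ∈ Finset.Ico 1 N, S n ^ 2 / n with hQ
  have e : 3 * (1 / Λ) * (1 / 60 * ∑ n ∈ Finset.Ico 1 N, (1 : ℝ) / n + 15 * ∑ n ∈ Finset.Ico 1 N, S n ^ 2 / n) =
      1 / 20 * P + 45 * Q := by rw [hP, hQ]; ring
  rw [e] at hsum
  linarith

lemma SS_eq (a W k t : ℕ) (h2 : 2 ∣ W) (h4 : (a + W * k) % 4 = 1) :
    SS a W k t = ∑ n ∈ Finset.Ico 2 (t + 1), Y (a + W * k) W n * (1 / (n : ℝ)) := by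
  unfold SS TT
  rw [Finset.sum_filter]
  have : Finset.Icc 2 t = Finset.Ico 2 (t + 1) := by ext; simp [Nat.lt_succ_iff]
  rw [this]
  refine Finset.sum_congr rfl fun n hn => ?_
  unfold Y
  split_ifs with h
  · have ho : Odd n := Nat.coprime_two_right.mp (Nat.Coprime.coprime_dvd_right h2 h)
    unfold J
    rw [jacobiSym.quadratic_reciprocity_one_mod_four h4 ho]
    ring
  · ring

lemma partial_small (a W k N : ℕ) (hW : W ≠ 0) (h2 : 2 ∣ W) (h4 : (a + W * k) % 4 = 1)
    (h1 : 1 < a + W * k) (hs : Squarefree (a + W * k)) (hN : 1 ≤ N) (Λ s : ℝ) (hΛ : 2 ≤ Λ)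
    (hNL : Real.log N ≤ Λ) (hs1 : s ≤ 1) (hs2 : 1 - 1 / Λ ≤ s)
    (hU : SS a W k N ^ 2 + 1 / Λ * ∑ n ∈ Finset.Ico 1 N, SS a W k n ^ 2 / n ≤ 1 / 200)
    (hPV : W * (Real.sqrt (a + W * k : ℕ) * (1 + Real.log (a + W * k : ℕ))) * 12 ≤ N) (M : ℕ) (hM : N + 1 ≤ M) :
    |∑ n ∈ Finset.Ico 2 M, Y (a + W * k) W n * (n : ℝ) ^ (-s)| ≤ 3 / 4 := by
  set d := a + W * k with hd
  have hodd : Odd d := by rw [Nat.odd_iff]; omega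
  rw [← Finset.sum_Ico_consecutive _ (by omega : 2 ≤ N + 1) hM]
  have hNp : (0 : ℝ) < N := by exact_mod_cast hN
  have hlam : 1 / Λ ≤ 1 / 2 := one_div_le_one_div_of_le (by norm_num) hΛ
  have h3 := rpow_le_three N hN Λ (1 - s) (by linarith) hNL (by linarith) (by linarith)
  have A1 := abel_small (fun n => Y d W n * (1 / (n : ℝ))) (SS a W k) (fun t => SS_eq a W k t h2 h4)
    N hN Λ (1 - s) (by linarith) hNL (by linarith) (by linarith) hU
  have e1 : ∑ n ∈ Finset.Ico 2 (N + 1), Y d W n * (1 / (n : ℝ)) * (n : ℝ) ^ (1 - s) =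
      ∑ n ∈ Finset.Ico 2 (N + 1), Y d W n * (n : ℝ) ^ (-s) := by
    refine Finset.sum_congr rfl fun n hn => ?_
    rw [Finset.mem_Ico] at hn
    have hp : (0 : ℝ) < n := by exact_mod_cast (by omega : 0 < n)
    rw [show 1 - s = -s + 1 by ring, Real.rpow_add_one hp.ne']
    field_simp
  rw [e1] at A1
  have A2 := abel_ineq (fun n => Y d W n) (fun n => (n : ℝ) ^ (-s)) (W * (Real.sqrt d * (1 + Real.log d))) (N + 1)
    (fun M => J_PV_coprime d h1 hodd hs W hW (N + 1) M)
    (fun n hn => by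
      have hp : (0 : ℝ) < n := by exact_mod_cast (by omega : 0 < n)
      exact Real.rpow_le_rpow_of_nonpos hp (by push_cast; linarith) (by linarith))
    (fun n _ => by positivity) M
  have A3 : ((N + 1 : ℕ) : ℝ) ^ (-s) ≤ 3 / N := by
    calc ((N + 1 : ℕ) : ℝ) ^ (-s) ≤ (N : ℝ) ^ (-s) :=
          Real.rpow_le_rpow_of_nonpos hNp (by push_cast; linarith) (by linarith)
      _ = (N : ℝ) ^ (1 - s) / N := by
          rw [show 1 - s = -s + 1 by ring, Real.rpow_add_one hNp.ne']; field_simp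
      _ ≤ _ := by gcongr
  have hC0 : 0 ≤ W * (Real.sqrt d * (1 + Real.log d)) := by
    have := Real.log_natCast_nonneg d
    positivity
  have A4 : W * (Real.sqrt d * (1 + Real.log d)) * ((N + 1 : ℕ) : ℝ) ^ (-s) ≤ 1 / 4 := by
    refine (mul_le_mul_of_nonneg_left A3 hC0).trans ?_
    rw [mul_div_assoc', div_le_iff₀ hNp]
    linarith
  have := abs_add_le (∑ n ∈ Finset.Ico 2 (N + 1), Y d W n * (n : ℝ) ^ (-s)) (∑ n ∈ Finset.Ico (N + 1) M, Y d W n * (n : ℝ) ^ (-s))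
  linarith


lemma markov_count (K : ℕ) (U : ℕ → ℝ) (hU : ∀ k, 0 ≤ U k) (B : ℝ) (hB : ∑ k ∈ Finset.range K, U k ≤ B) :
    (((Finset.range K).filter (fun k => ¬ U k ≤ 1 / 200)).card : ℝ) ≤ 200 * B := by
  have h1 : ∑ k ∈ (Finset.range K).filter (fun k => ¬ U k ≤ 1 / 200), (1 / 200 : ℝ) ≤
      ∑ k ∈ (Finset.range K).filter (fun k => ¬ U k ≤ 1 / 200), U k := by
    refine Finset.sum_le_sum fun k hk => ?_
    rw [Finset.mem_filter] at hk
    linarith [hk.2]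
  have h2 : ∑ k ∈ (Finset.range K).filter (fun k => ¬ U k ≤ 1 / 200), U k ≤ ∑ k ∈ Finset.range K, U k :=
    Finset.sum_le_sum_of_subset_of_nonneg (Finset.filter_subset _ _) (fun k _ _ => hU k)
  rw [Finset.sum_const, nsmul_eq_mul] at h1
  linarith

/-- quantity controlling the partial sums -/
noncomputable def UU (a W N : ℕ) (Λ : ℝ) (k : ℕ) : ℝ :=
  SS a W k N ^ 2 + 1 / Λ * ∑ n ∈ Finset.Ico 1 N, SS a W k n ^ 2 / n

lemma UU_nonneg (a W N : ℕ) (Λ : ℝ) (hΛ : 0 ≤ Λ) (k : ℕ) : 0 ≤ UU a W N Λ k := by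
  unfold UU
  have : 0 ≤ ∑ n ∈ Finset.Ico 1 N, SS a W k n ^ 2 / n := Finset.sum_nonneg fun n _ => by positivity
  positivity

lemma UU_sum (z W a K N : ℕ) (hz : 2 ≤ z) (hW : ∀ p : ℕ, p.Prime → p ≤ z → p ∣ W) (hN : 1 ≤ N)
    (Λ : ℝ) (hΛ : 1 ≤ Λ) (hNL : Real.log N ≤ Λ) :
    ∑ k ∈ Finset.range K, UU a W N Λ k ≤ 3 * (K * (12 / z) + 4 * N * (1 + 2 * Real.log N)) := by
  set B : ℝ := K * (12 / z) + 4 * N * (1 + 2 * Real.log N) with hB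
  have hl := Real.log_natCast_nonneg N
  have hB0 : 0 ≤ B := by positivity
  have hsm : ∀ n, 1 ≤ n → n ≤ N → ∑ k ∈ Finset.range K, SS a W k n ^ 2 ≤ B := by
    intro n h1 h2
    refine (second_moment z W a K n hz hW h1).trans ?_
    have hnp : (0 : ℝ) < n := by exact_mod_cast h1
    have e1 : (n : ℝ) ≤ N := by exact_mod_cast h2
    have e2 : Real.log n ≤ Real.log N := Real.log_le_log hnp e1
    have e3 := Real.log_natCast_nonneg n
    rw [hB]
    gcongr
  unfold UU
  rw [Finset.sum_add_distrib, ← Finset.mul_sum, Finset.sum_comm]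
  have h1 : ∑ n ∈ Finset.Ico 1 N, ∑ k ∈ Finset.range K, SS a W k n ^ 2 / n ≤
      ∑ n ∈ Finset.Ico 1 N, B * (1 / n) := by
    refine Finset.sum_le_sum fun n hn => ?_
    rw [Finset.mem_Ico] at hn
    rw [← Finset.sum_div, div_eq_mul_one_div]
    exact mul_le_mul_of_nonneg_right (hsm n hn.1 hn.2.le) (by positivity)
  rw [← Finset.mul_sum] at h1
  have h2 : B * ∑ n ∈ Finset.Ico 1 N, 1 / (n : ℝ) ≤ B * (2 * Λ) :=
    mul_le_mul_of_nonneg_left ((sum_inv_le_log N).trans (by linarith)) hB0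
  have h3 : 1 / Λ * ∑ n ∈ Finset.Ico 1 N, ∑ k ∈ Finset.range K, SS a W k n ^ 2 / n ≤ 1 / Λ * (B * (2 * Λ)) :=
    mul_le_mul_of_nonneg_left (h1.trans h2) (by positivity)
  have h4 : 1 / Λ * (B * (2 * Λ)) = 2 * B := by field_simp
  have h5 := hsm N hN le_rfl
  linarith

lemma count_good (z a K R N k0 : ℕ) (hz : 2 ≤ z) (haz : a < WW z)
    (ha : ∀ k, ∀ p, p.Prime → p ≤ z → J p (a + WW z * k) = -1)
    (hodd : ∀ k, Odd (a + WW z * k)) (hR : WW z * K ≤ R ^ 2) (hN : 1 ≤ N)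
    (Λ : ℝ) (hΛ : 1 ≤ Λ) (hNL : Real.log N ≤ Λ) :
    (K : ℝ) - (K / z + R) - 600 * (K * (12 / z) + 4 * N * (1 + 2 * Real.log N)) - k0 ≤
      ((Finset.range K).filter (fun k => Squarefree (a + WW z * k) ∧ UU a (WW z) N Λ k ≤ 1 / 200 ∧ k0 ≤ k)).card := by
  classical
  have c1 := count_nonsqfree z a K R hz haz ha hodd hR
  have c2 := markov_count K (UU a (WW z) N Λ) (UU_nonneg a (WW z) N Λ (by linarith)) _
    (UU_sum z (WW z) a K N hz (fun p hp h => (prime_dvd_WW hp).mpr h) hN Λ hΛ hNL)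
  set G := (Finset.range K).filter (fun k => Squarefree (a + WW z * k) ∧ UU a (WW z) N Λ k ≤ 1 / 200 ∧ k0 ≤ k)
  set B1 := (Finset.range K).filter (fun k => ¬ Squarefree (a + WW z * k))
  set B2 := (Finset.range K).filter (fun k => ¬ UU a (WW z) N Λ k ≤ 1 / 200)
  have hsub : Finset.range K ⊆ G ∪ (B1 ∪ (B2 ∪ Finset.range k0)) := by
    intro k hk
    simp only [G, B1, B2, Finset.mem_union, Finset.mem_filter, Finset.mem_range] at hk ⊢
    by_cases h1 : Squarefree (a + WW z * k)
    · by_cases h2 : UU a (WW z) N Λ k ≤ 1 / 200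
      · by_cases h3 : k0 ≤ k
        · exact Or.inl ⟨hk, h1, h2, h3⟩
        · right; right; right; omega
      · right; right; left; exact ⟨hk, h2⟩
    · right; left; exact ⟨hk, h1⟩
  have h := Finset.card_le_card hsub
  have h2 := Finset.card_union_le G (B1 ∪ (B2 ∪ Finset.range k0))
  have h3 := Finset.card_union_le B1 (B2 ∪ Finset.range k0)
  have h4 := Finset.card_union_le B2 (Finset.range k0)
  rw [Finset.card_range] at h h4
  have h5 : (K : ℝ) ≤ G.card + (B1.card + (B2.card + k0)) := by
    exact_mod_cast (by omega : K ≤ G.card + (B1.card + (B2.card + k0)))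
  linarith

lemma euler_factor (d z : ℕ) (hd : d ≠ 0) (hJ : ∀ p, p.Prime → p ≤ z → J p d = -1) :
    ∏ p ∈ (d * WW z).primeFactors, (1 - J p d * (p : ℝ) ^ (-(1 : ℝ))) =
      ∏ p ∈ (z + 1).primesBelow, (1 + 1 / (p : ℝ)) := by
  have hne : d * WW z ≠ 0 := mul_ne_zero hd (WW_pos z).ne'
  symm
  have e : ∏ p ∈ (z + 1).primesBelow, (1 + 1 / (p : ℝ)) =
      ∏ p ∈ (z + 1).primesBelow, (1 - J p d * (p : ℝ) ^ (-(1 : ℝ))) := by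
    refine Finset.prod_congr rfl fun p hp => ?_
    rw [hJ p (Nat.prime_of_mem_primesBelow hp) (Nat.lt_succ_iff.mp (Nat.lt_of_mem_primesBelow hp)), Real.rpow_neg_one]
    ring
  rw [e]
  apply Finset.prod_subset
  · intro p hp
    have h1 := Nat.prime_of_mem_primesBelow hp
    have h2 := Nat.lt_of_mem_primesBelow hp
    rw [Nat.mem_primeFactors]
    exact ⟨h1, ((prime_dvd_WW h1).mpr (by omega)).mul_left d, hne⟩
  · intro p hp hnp
    rw [Nat.mem_primeFactors] at hp
    have h1 : ¬ p ≤ z := by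
      intro h
      exact hnp (Nat.mem_primesBelow.mpr ⟨by omega, hp.1⟩)
    have h2 : p ∣ d := by
      rcases hp.1.dvd_mul.mp hp.2.1 with h | h
      · exact h
      · exact absurd ((prime_dvd_WW hp.1).mp h) h1
    rw [J_eq_zero hd]
    · simp
    · intro hc
      have := Nat.dvd_gcd (dvd_refl p) h2
      rw [hc] at this
      exact hp.1.one_lt.ne' (Nat.dvd_one.mp this)

lemma good_props (z a k N : ℕ) (hz : 3 ≤ z) (h8 : (a + WW z * k) % 8 = 5)
    (hJ : ∀ p, p.Prime → p ≤ z → J p (a + WW z * k) = -1)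
    (hs : Squarefree (a + WW z * k)) (hN : 1 ≤ N) (Λ : ℝ) (hΛ : 2 ≤ Λ)
    (hNL : Real.log N ≤ Λ) (hU : UU a (WW z) N Λ k ≤ 1 / 200)
    (hPV : WW z * (Real.sqrt (a + WW z * k : ℕ) * (1 + Real.log (a + WW z * k : ℕ))) * 12 ≤ N)
    (hlow : Λ ≤ 2 * Real.log (a + WW z * k : ℕ)) (hne : NeZero (a + WW z * k)) :
    HasNoSiegelZero (1 / 2) (a + WW z * k) (jchar (a + WW z * k)) ∧
    ∃ l, HasCurlyL (jchar (a + WW z * k)) l ∧ l ≤ Real.log 4 - Real.log (Real.log z) := by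
  have h1 : 1 < a + WW z * k := by omega
  have hodd : Odd (a + WW z * k) := by rw [Nat.odd_iff]; omega
  have hps := partial_small a (WW z) k N (WW_pos z).ne' ((prime_dvd_WW Nat.prime_two).mpr (by omega)) (by omega)
    h1 hs hN Λ
  set d := a + WW z * k with hd
  have hlam : 1 / Λ ≤ 1 / 2 := one_div_le_one_div_of_le (by norm_num) hΛ
  have hlam0 : 0 < 1 / Λ := by positivity
  have hctl : ∀ s : ℝ, 1 - 1 / Λ ≤ s → s ≤ 1 → _ := fun s hs1 hs2 =>
    L_control d (WW z) (WW_pos z).ne' h1 hodd hs s (by linarith) (N + 1)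
      (fun M hM => hps s hΛ hNL hs2 hs1 hU hPV M hM)
  constructor
  · rintro ⟨β, hb1, hb2, hb3⟩
    have hlogd : 0 < Real.log d := by linarith
    have hle : 1 / 2 / Real.log d ≤ 1 / Λ := by
      rw [div_div, div_le_div_iff₀ (by positivity) (by linarith)]
      linarith
    have := (hctl β (by linarith) hb2).1
    apply this
    unfold LFun at hb3
    rw [dif_pos (by omega)] at hb3
    exact hb3
  · obtain ⟨l, hl, hle⟩ := curly_d d h1 hodd hs
    refine ⟨l, hl, ?_⟩
    have h2 := (hctl 1 (by linarith) le_rfl).2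
    rw [euler_factor d z (by omega) hJ] at h2
    have hm := mertens_prod z
    have hz1 : 1 < Real.log z := by
      rw [Real.lt_log_iff_exp_lt (by exact_mod_cast (by omega : 0 < z))]
      have : (3 : ℝ) ≤ z := by exact_mod_cast hz
      linarith [Real.exp_one_lt_d9]
    have he := Real.exp_pos l
    have h3 : Real.exp l * (Real.log z / 2) ≤ 2 :=
      (mul_le_mul hle hm (by linarith) (he.le.trans hle)).trans h2
    rw [← Real.log_div (by norm_num) (by linarith), Real.le_log_iff_exp_le (by positivity),
      le_div_iff₀ (by linarith)]
    linarith


lemma family (X : ℝ) (z : ℕ) (hX : 100 ≤ X) (hlog : 1 + 2 * Real.log (X ^ 20) ≤ X ^ 2)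
    (hz : 30000 ≤ z) (hW : (WW z : ℝ) ≤ X) :
    ∃ F : Finset ℕ, X ^ 20 / (8 * X) ≤ F.card ∧ X ^ 20 / (8 * WW z) ≤ F.card ∧ ∀ d ∈ F, (d : ℝ) ≤ X ^ 20 ∧ d % 4 = 1 ∧ Squarefree d ∧
      1 < d ∧ (∃ χ : DirichletCharacter ℂ d, χ.IsPrimitive ∧ MulChar.IsQuadratic χ ∧
              HasNoSiegelZero (1 / 2) d χ ∧
              ∃ L : ℝ, HasCurlyL χ L ∧ L ≤ Real.log 4 - Real.log (Real.log z)) := by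
  obtain ⟨a, haW, ha⟩ := exists_a z (by omega)
  have hX0 : 0 < X := by linarith
  have hWp : (0 : ℝ) < WW z := by exact_mod_cast WW_pos z
  have hW1 : (1 : ℝ) ≤ WW z := by exact_mod_cast WW_pos z
  set N := ⌊X ^ 15⌋₊ with hNdef
  set K := ⌊X ^ 20 / WW z⌋₊ with hKdef
  set R := ⌈X ^ 10⌉₊ with hRdef
  set Λ := Real.log (X ^ 20) with hΛdef
  have hN1 : (N : ℝ) ≤ X ^ 15 := Nat.floor_le (by positivity)
  have hN2 : X ^ 15 < N + 1 := Nat.lt_floor_add_one _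
  have hK1 : (K : ℝ) ≤ X ^ 20 / WW z := Nat.floor_le (by positivity)
  have hK2 : X ^ 20 / WW z < K + 1 := Nat.lt_floor_add_one _
  have hR1 : X ^ 10 ≤ R := Nat.le_ceil _
  have hR2 : (R : ℝ) < X ^ 10 + 1 := Nat.ceil_lt_add_one (by positivity)
  have hWK : (WW z : ℝ) * K ≤ X ^ 20 := by
    rw [le_div_iff₀ hWp] at hK1; linarith
  have hX1 : 1 ≤ X := by linarith
  have p15 : (100 : ℝ) ≤ X ^ 15 := hX.trans (le_self_pow₀ hX1 (by norm_num))
  have hN : 1 ≤ N := by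
    have : (0 : ℝ) < N := by linarith
    exact_mod_cast this
  have hNp : (0 : ℝ) < N := by exact_mod_cast hN
  have hNL : Real.log N ≤ Λ := Real.log_le_log hNp (hN1.trans (pow_le_pow_right₀ hX1 (by norm_num)))
  have hΛ : 2 ≤ Λ := by
    rw [hΛdef, Real.log_pow]
    have : 1 ≤ Real.log X := by
      rw [Real.le_log_iff_exp_le hX0]
      linarith [Real.exp_one_lt_d9]
    push_cast; linarith
  have hodd : ∀ k, Odd (a + WW z * k) := fun k => by
    rw [Nat.odd_iff]; have := (ha k).1; omega
  have hR3 : WW z * K ≤ R ^ 2 := by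
    have : ((WW z * K : ℕ) : ℝ) ≤ ((R ^ 2 : ℕ) : ℝ) := by
      push_cast
      refine hWK.trans ?_
      calc X ^ 20 = (X ^ 10) ^ 2 := by ring
        _ ≤ _ := by gcongr
    exact_mod_cast this
  have hcount := count_good z a K R N R (by omega) haW (fun k => (ha k).2) hodd hR3 hN Λ (by linarith) hNL
  set G := (Finset.range K).filter (fun k => Squarefree (a + WW z * k) ∧ UU a (WW z) N Λ k ≤ 1 / 200 ∧ R ≤ k) with hG
  have hzr : (30000 : ℝ) ≤ z := by exact_mod_cast hz
  have hKz : (K : ℝ) / z ≤ K / 30000 := by gcongr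
  have hl1 : 1 + 2 * Real.log N ≤ X ^ 2 := by linarith
  have hlN := Real.log_natCast_nonneg N
  have hNX : 4 * (N : ℝ) * (1 + 2 * Real.log N) ≤ 4 * X ^ 17 := by
    calc 4 * (N : ℝ) * (1 + 2 * Real.log N) ≤ 4 * X ^ 15 * X ^ 2 := by gcongr
      _ = 4 * X ^ 17 := by ring
  have p17 : X ^ 19 = X ^ 17 * X ^ 2 := by ring
  have p10 : X ^ 10 ≤ X ^ 17 := pow_le_pow_right₀ hX1 (by norm_num)
  have p17' : (100 : ℝ) ≤ X ^ 17 := hX.trans (le_self_pow₀ hX1 (by norm_num))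
  have p2 : (10000 : ℝ) ≤ X ^ 2 := by nlinarith
  have hQ : X ^ 19 ≤ X ^ 20 / WW z := by
    rw [le_div_iff₀ hWp]
    calc X ^ 19 * WW z ≤ X ^ 19 * X := by gcongr
      _ = X ^ 20 := by ring
  have h19 : 10000 * X ^ 17 ≤ X ^ 19 := by rw [p17]; nlinarith
  have hcard : X ^ 20 / WW z / 8 ≤ G.card := by
    have e1 : (K : ℝ) * (12 / z) = 12 * (K / z) := by ring
    rw [e1] at hcount
    nlinarith
  refine ⟨G.image (fun k => a + WW z * k), ?_, ?_, ?_⟩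
  · rw [Finset.card_image_of_injective]
    · refine le_trans (le_of_eq ?_) ((div_le_div_of_nonneg_right hQ (by norm_num : (0:ℝ) ≤ 8)).trans hcard)
      field_simp
    · intro k l hkl
      dsimp only at hkl
      exact Nat.eq_of_mul_eq_mul_left (WW_pos z) (by omega)
  · rw [Finset.card_image_of_injective]
    · refine le_trans (le_of_eq ?_) hcard
      field_simp
    · intro k l hkl
      dsimp only at hkl
      exact Nat.eq_of_mul_eq_mul_left (WW_pos z) (by omega)
  · intro d hd
    rw [Finset.mem_image] at hd
    obtain ⟨k, hk, hkd⟩ := hd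
    rw [hG, Finset.mem_filter, Finset.mem_range] at hk
    obtain ⟨hkK, hsq, hUk, hRk⟩ := hk
    have h8 := (ha k).1
    have hdX : ((a + WW z * k : ℕ) : ℝ) ≤ X ^ 20 := by
      refine le_trans ?_ hWK
      have h1 : WW z * (k + 1) ≤ WW z * K := Nat.mul_le_mul_left _ hkK
      rw [mul_add] at h1
      exact_mod_cast (by omega : a + WW z * k ≤ WW z * K)
    have hdk : X ^ 10 ≤ ((a + WW z * k : ℕ) : ℝ) := by
      refine hR1.trans ?_
      have : k ≤ WW z * k := Nat.le_mul_of_pos_left k (WW_pos z)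
      exact_mod_cast (by omega : R ≤ a + WW z * k)
    have hdp : (0 : ℝ) < ((a + WW z * k : ℕ) : ℝ) := lt_of_lt_of_le (by positivity) hdk
    have hne : NeZero (a + WW z * k) := ⟨by omega⟩
    have hlow : Λ ≤ 2 * Real.log (a + WW z * k : ℕ) := by
      have h1 : Real.log (X ^ 10) ≤ Real.log (a + WW z * k : ℕ) := Real.log_le_log (by positivity) hdk
      rw [hΛdef, Real.log_pow]
      rw [Real.log_pow] at h1
      push_cast at h1 ⊢
      linarith
    have hlogd : Real.log (a + WW z * k : ℕ) ≤ Λ := Real.log_le_log hdp hdX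
    have hlogd0 := Real.log_natCast_nonneg (a + WW z * k)
    have hsqrt : Real.sqrt (a + WW z * k : ℕ) ≤ X ^ 10 := by
      apply Real.sqrt_le_iff.mpr
      exact ⟨by positivity, hdX.trans (le_of_eq (by ring))⟩
    have hPV : WW z * (Real.sqrt (a + WW z * k : ℕ) * (1 + Real.log (a + WW z * k : ℕ))) * 12 ≤ N := by
      calc WW z * (Real.sqrt (a + WW z * k : ℕ) * (1 + Real.log (a + WW z * k : ℕ))) * 12
          ≤ X * (X ^ 10 * X ^ 2) * 12 := by
            gcongr
            linarith
        _ = 12 * X ^ 13 := by ring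
        _ ≤ X ^ 15 - 1 := by
            have : X ^ 15 = X ^ 13 * X ^ 2 := by ring
            have h13 : (1 : ℝ) ≤ X ^ 13 := one_le_pow₀ hX1
            rw [this]; nlinarith
        _ ≤ N := by linarith
    have key := good_props z a k N (by omega) h8 (ha k).2 hsq hN Λ hΛ hNL hUk hPV hlow hne
    subst hkd
    exact ⟨hdX, by omega, hsq, by omega, jchar _, jchar_primitive _ (hodd k) hsq, jchar_quadratic _, key.1, key.2⟩

theorem statement_6 (ε : ℝ) (hε : 0 < ε) :
    ∃ c > (0:ℝ), ∃ A > (0:ℝ), ∀ᶠ D : ℝ in atTop,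
      D ^ (1 - ε) ≤
        (Nat.card {d : ℕ // (d : ℝ) ≤ D ∧ IsFundamentalDiscriminant d ∧
            ∃ χ : DirichletCharacter ℂ d, χ.IsPrimitive ∧ MulChar.IsQuadratic χ ∧
              HasNoSiegelZero c d χ ∧
              ∃ L : ℝ, HasCurlyL χ L ∧
                L ≤ -(Real.log (Real.log (Real.log D))) + A} : ℝ) := by
  refine ⟨1 / 2, by norm_num, Real.log 8, Real.log_pos (by norm_num), ?_⟩
  set η : ℝ := min ε (1 / 10) with hη
  have hη0 : 0 < η := lt_min hε (by norm_num)
  have hη1 : η ≤ 1 / 10 := min_le_right _ _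
  have hηε : η ≤ ε := min_le_left _ _
  have T1 : Tendsto (fun D : ℝ => D ^ (1 / 20 : ℝ)) atTop atTop := tendsto_rpow_atTop (by norm_num)
  have T2 : Tendsto (fun D : ℝ => D ^ (η / 2)) atTop atTop := tendsto_rpow_atTop (by linarith)
  have T3 := Real.tendsto_log_atTop
  have E1 : ∀ᶠ D : ℝ in atTop, Real.log D ≤ D ^ (1 / 10 : ℝ) / 3 := by
    have := (isLittleO_log_rpow_atTop (r := 1 / 10) (by norm_num)).bound (c := 1 / 3) (by norm_num)
    filter_upwards [this, eventually_gt_atTop 0] with D hD h0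
    rw [Real.norm_eq_abs, Real.norm_eq_abs, abs_of_nonneg (Real.rpow_nonneg h0.le _)] at hD
    linarith [le_abs_self (Real.log D)]
  filter_upwards [E1, T1.eventually_ge_atTop 100, T2.eventually_ge_atTop 8, eventually_gt_atTop 1,
    T3.eventually_ge_atTop (400 / η ^ 2 + 10), T3.eventually_ge_atTop (30001 * (10 / η))]
    with D hlogD hX h8 hD1 hL1 hL2
  have hD0 : 0 < D := by linarith
  set X := D ^ (1 / 20 : ℝ) with hXdef
  have hX20 : X ^ 20 = D := by
    rw [hXdef, ← Real.rpow_natCast, ← Real.rpow_mul hD0.le]; norm_num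
  have hX2 : X ^ 2 = D ^ (1 / 10 : ℝ) := by
    rw [hXdef, ← Real.rpow_natCast, ← Real.rpow_mul hD0.le]; norm_num
  have hLp : 10 ≤ Real.log D := by
    have : 0 ≤ 400 / η ^ 2 := by positivity
    linarith
  set z := ⌊η / 10 * Real.log D⌋₊ with hzdef
  have hz1 : (z : ℝ) ≤ η / 10 * Real.log D := Nat.floor_le (by positivity)
  have hz2 : η / 10 * Real.log D < z + 1 := Nat.lt_floor_add_one _
  have hz3 : 30001 ≤ η / 10 * Real.log D := by
    have := mul_le_mul_of_nonneg_left hL2 (by positivity : 0 ≤ η / 10)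
    refine le_trans (le_of_eq ?_) this
    field_simp
  have hz : 30000 ≤ z := by
    have : (30000 : ℝ) < z + 1 := by linarith
    have : (30000 : ℕ) < z + 1 := by exact_mod_cast this
    omega
  have hWD : (WW z : ℝ) ≤ D ^ (η / 2) := by
    have h1 : (WW z : ℝ) ≤ (64 : ℝ) ^ z := by exact_mod_cast WW_le z
    refine h1.trans ?_
    rw [← Real.rpow_natCast, Real.rpow_def_of_pos (by norm_num), Real.rpow_def_of_pos hD0]
    apply Real.exp_le_exp.mpr
    have h64 : Real.log 64 ≤ 5 := by
      rw [show (64 : ℝ) = 2 ^ 6 by norm_num, Real.log_pow]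
      have := Real.log_two_lt_d9
      push_cast; linarith
    calc Real.log 64 * z ≤ 5 * (η / 10 * Real.log D) := by gcongr
      _ = Real.log D * (η / 2) := by ring
  have hWX : (WW z : ℝ) ≤ X := by
    refine hWD.trans ?_
    exact Real.rpow_le_rpow_of_exponent_le hD1.le (by linarith)
  obtain ⟨F, _, hF, hFd⟩ := family X z hX (by
    rw [hX20, hX2]
    have : (10000 : ℝ) ≤ X ^ 2 := by nlinarith
    rw [hX2] at this
    linarith) hz hWX
  rw [hX20] at hF hFd
  -- the count
  set S : Set ℕ := {d : ℕ | (d : ℝ) ≤ D ∧ IsFundamentalDiscriminant d ∧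
            ∃ χ : DirichletCharacter ℂ d, χ.IsPrimitive ∧ MulChar.IsQuadratic χ ∧
              HasNoSiegelZero (1 / 2) d χ ∧
              ∃ L : ℝ, HasCurlyL χ L ∧
                L ≤ -(Real.log (Real.log (Real.log D))) + Real.log 8} with hS
  have hfin : S.Finite := by
    apply (Set.finite_Iic ⌊D⌋₊).subset
    intro d hd
    exact Nat.le_floor hd.1
  have hzz : Real.log 4 - Real.log (Real.log z) ≤ -(Real.log (Real.log (Real.log D))) + Real.log 8 := by
    have hzge : η / 20 * Real.log D ≤ z := by linarith
    have hsq : Real.sqrt (Real.log D) ≤ z := by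
      refine le_trans ?_ hzge
      have hs : 20 / η ≤ Real.sqrt (Real.log D) := by
        apply Real.le_sqrt_of_sq_le
        have : (20 / η) ^ 2 = 400 / η ^ 2 := by rw [div_pow]; norm_num
        linarith
      rw [div_le_iff₀ hη0] at hs
      have hss := Real.mul_self_sqrt (by linarith : 0 ≤ Real.log D)
      have hs0 := Real.sqrt_nonneg (Real.log D)
      nlinarith
    have h1 : Real.log (Real.log D) / 2 ≤ Real.log z := by
      rw [← Real.log_sqrt (by linarith)]
      exact Real.log_le_log (Real.sqrt_pos.mpr (by linarith)) hsq
    have hll : 0 < Real.log (Real.log D) := Real.log_pos (by linarith)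
    have h2 : Real.log (Real.log (Real.log D) / 2) ≤ Real.log (Real.log z) :=
      Real.log_le_log (by linarith) h1
    rw [Real.log_div hll.ne' (by norm_num)] at h2
    have h48 : Real.log 8 = Real.log 4 + Real.log 2 := by
      rw [← Real.log_mul (by norm_num) (by norm_num)]; norm_num
    linarith
  have hsub : (F : Set ℕ) ⊆ S := by
    intro d hd
    obtain ⟨q1, q2, q3, q4, χ, q5, q6, q7, l, q8, q9⟩ := hFd d hd
    exact ⟨q1, ⟨by omega, Or.inl ⟨q2, q3⟩⟩, χ, q5, q6, q7, l, q8, q9.trans hzz⟩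
  have hcard : F.card ≤ Nat.card S := by
    have := Set.ncard_le_ncard hsub hfin
    rwa [Set.ncard_coe_finset, ← Nat.card_coe_set_eq] at this
  have hcard' : (F.card : ℝ) ≤ (Nat.card S : ℝ) := by exact_mod_cast hcard
  refine le_trans ?_ hcard'
  refine le_trans ?_ hF
  have hWp : (0 : ℝ) < WW z := by exact_mod_cast WW_pos z
  rw [le_div_iff₀ (by positivity)]
  calc D ^ (1 - ε) * (8 * WW z) ≤ D ^ (1 - η) * (D ^ (η / 2) * D ^ (η / 2)) := by
        gcongr
        · exact hD1.le
    _ = D := by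
        rw [← Real.rpow_add hD0, ← Real.rpow_add hD0]
        rw [show 1 - η + (η / 2 + η / 2) = 1 by ring, Real.rpow_one]
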